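/- Let p₁, q₁, p₂, q₂ be prime numbers, all at least 3, such that the unordered pairs {p₁, q₁} and {p₂, q₂} are distinct. Then the groups C_{p₁} ∗ C_{q₁} and C_{p₂} ∗ C_{q₂} do not act properly cocompactly on the same proper metric space: there is no nonempty proper metric space X (closed balls compact) equipped with actions of Γ₁ := C_{p₁} ∗ C_{q₁} and of Γ₂ := C_{p₂} ∗ C_{q₂} by surjective isometries, each of which is metrically proper (for every bounded set B ⊆ X, the set {γ ∈ Γᵢ : γ·B ∩ B ≠ ∅} is finite) and cocompact (there is a compact set K ⊆ X with Γᵢ·K = X). -/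

import Mathlib

universe u

open Pointwise Bornology Filter

section Words

open Monoid

variable {C : Bool → Type} [∀ i, Group (C i)]

open scoped Classical in
/-- The leading letter of an element of a free product if it lies in the factor `i`, and `1`
otherwise. -/
noncomputable def firstLetter (i : Bool) (γ : CoprodI C) : C i :=
  (CoprodI.Word.equivPair i (CoprodI.Word.equiv γ)).head

open scoped Classical in
/-- The syllable length of an element of a free product. -/
noncomputable def syllableLength (γ : CoprodI C) : ℕ :=
  (CoprodI.Word.equiv γ).toList.length

theorem firstLetter_of_mul {i : Bool} (a : C i) (γ : CoprodI C) :
    firstLetter i (CoprodI.of a * γ) = a * firstLetter i γ := by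
  classical
  change (CoprodI.Word.equivPair i
    ((CoprodI.of a * γ) • (CoprodI.Word.empty : CoprodI.Word C))).head = _
  rw [mul_smul, CoprodI.Word.equivPair_smul_same]
  rfl

open scoped Classical in
theorem firstLetter_eq_one_iff {i : Bool} {γ : CoprodI C} :
    firstLetter i γ = 1 ↔ (CoprodI.Word.equiv γ).fstIdx ≠ some i := by
  constructor
  · intro h
    have h1 := CoprodI.Word.equivPair_head_smul_equivPair_tail (i := i) (CoprodI.Word.equiv γ)
    have h2 : (CoprodI.Word.equivPair i (CoprodI.Word.equiv γ)).head = 1 := h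
    rw [h2, map_one, one_smul] at h1
    rw [← h1]
    exact (CoprodI.Word.equivPair i (CoprodI.Word.equiv γ)).fstIdx_ne
  · intro h
    change (CoprodI.Word.equivPair i (CoprodI.Word.equiv γ)).head = 1
    rw [CoprodI.Word.equivPair_eq_of_fstIdx_ne h]

theorem firstLetter_one (i : Bool) : firstLetter i (1 : CoprodI C) = 1 := by
  classical
  rw [firstLetter_eq_one_iff]
  change ((1 : CoprodI C) • (CoprodI.Word.empty : CoprodI.Word C)).fstIdx ≠ some i
  rw [one_smul]
  simp [CoprodI.Word.fstIdx]

theorem firstLetter_not {i : Bool} {γ : CoprodI C} (h : firstLetter i γ ≠ 1) :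
    firstLetter (!i) γ = 1 := by
  classical
  rw [Ne, firstLetter_eq_one_iff, not_not] at h
  rw [firstLetter_eq_one_iff, h]
  simp

theorem firstLetter_of_not {i : Bool} {γ : CoprodI C} (h : firstLetter (!i) γ ≠ 1) :
    firstLetter i γ = 1 := by
  by_contra hi
  exact h (firstLetter_not hi)

theorem exists_firstLetter_ne_one {γ : CoprodI C} (h : γ ≠ 1) : ∃ i, firstLetter i γ ≠ 1 := by
  classical
  by_contra! hc
  apply h
  apply CoprodI.Word.equiv.injective
  have h1 : CoprodI.Word.equiv (1 : CoprodI C) = CoprodI.Word.empty :=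
    one_smul (CoprodI C) (CoprodI.Word.empty : CoprodI.Word C)
  rw [h1]
  ext1
  rcases hl : (CoprodI.Word.equiv γ).toList with _ | ⟨⟨i, a⟩, l⟩
  · rfl
  · exact absurd (by simp [CoprodI.Word.fstIdx, hl]) (firstLetter_eq_one_iff.1 (hc i))

theorem syllableLength_of_mul {i : Bool} {a : C i} {γ : CoprodI C} (ha : a ≠ 1)
    (h : firstLetter i γ = 1) :
    syllableLength (CoprodI.of a * γ) = syllableLength γ + 1 := by
  classical
  rw [firstLetter_eq_one_iff] at h
  have h1 : CoprodI.Word.equiv (CoprodI.of a * γ) = CoprodI.Word.cons a _ h ha := by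
    rw [CoprodI.Word.cons_eq_smul]
    exact mul_smul (CoprodI.of a) γ (CoprodI.Word.empty : CoprodI.Word C)
  have h2 := congrArg (fun w => w.toList.length) h1
  simp only [CoprodI.Word.cons_toList, List.length_cons] at h2
  unfold syllableLength
  convert h2

/-- Induction on reduced words, adding letters on the left. -/
theorem reducedWord_induction {motive : CoprodI C → Prop} (one : motive 1)
    (mul : ∀ (i : Bool) (a : C i) (w : CoprodI C), a ≠ 1 → firstLetter i w = 1 → motive w →
      motive (CoprodI.of a * w)) (γ : CoprodI C) : motive γ := by
  induction hn : syllableLength γ using Nat.strong_induction_on generalizing γ with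
  | _ n ih =>
    by_cases h : γ = 1
    · rwa [h]
    obtain ⟨i, hi⟩ := exists_firstLetter_ne_one h
    set a := firstLetter i γ with ha
    have hw : firstLetter i (CoprodI.of a⁻¹ * γ) = 1 := by
      rw [firstLetter_of_mul, ← ha, inv_mul_cancel]
    have hγ : γ = CoprodI.of a * (CoprodI.of a⁻¹ * γ) := by simp [← mul_assoc]
    rw [hγ]
    refine mul i a _ hi hw (ih _ ?_ _ rfl)
    have := syllableLength_of_mul hi hw
    rw [← hγ] at this
    omega

theorem firstLetter_mul_of {k : Bool} (s : C k) (γ : CoprodI C)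
    (hγ : γ ∉ Set.range (CoprodI.of : C k →* CoprodI C)) (i : Bool) :
    firstLetter i (γ * CoprodI.of s) = firstLetter i γ := by
  induction γ using reducedWord_induction generalizing i with
  | one => exact absurd ⟨1, map_one _⟩ hγ
  | mul j a w ha hw ih =>
    have key : firstLetter j (w * CoprodI.of s) = 1 := by
      by_cases hwk : w ∈ Set.range (CoprodI.of : C k →* CoprodI C)
      · obtain ⟨c, rfl⟩ := hwk
        rcases Bool.eq_or_eq_not k j with rfl | h
        · exact absurd ⟨a * c, map_mul _ _ _⟩ hγ
        · have hj : j = !k := by simp [h]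
          subst hj
          by_cases hcs : c * s = 1
          · rw [← map_mul, hcs, map_one, firstLetter_one]
          · apply firstLetter_not
            rw [← map_mul, ← mul_one (CoprodI.of (c * s)), firstLetter_of_mul, firstLetter_one,
              mul_one]
            exact hcs
      · rw [ih hwk, hw]
    have h1 : firstLetter j (CoprodI.of a * w * CoprodI.of s) = a := by
      rw [mul_assoc, firstLetter_of_mul, key, mul_one]
    have h2 : firstLetter j (CoprodI.of a * w) = a := by rw [firstLetter_of_mul, hw, mul_one]
    rcases Bool.eq_or_eq_not i j with rfl | rfl
    · rw [h1, h2]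
    · rw [firstLetter_not (h1.trans_ne ha), firstLetter_not (h2.trans_ne ha)]

theorem finite_firstLetter_mul_ne [∀ i, Finite (C i)] (t : CoprodI C) (i : Bool) :
    {γ | firstLetter i (γ * t) ≠ firstLetter i γ}.Finite := by
  induction t using CoprodI.induction_on with
  | one => simp
  | of k s =>
    refine (Set.finite_range (CoprodI.of : C k →* CoprodI C)).subset fun γ hγ => ?_
    by_contra h
    exact hγ (firstLetter_mul_of s γ h i)
  | mul x y hx hy =>
    refine (hx.union (hy.preimage (mul_left_injective x).injOn)).subset fun γ hγ => ?_
    by_contra h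
    simp only [Set.mem_union, Set.mem_preimage, Set.mem_ofPred_eq, not_or, not_not] at h
    exact hγ (by rw [← mul_assoc, h.2, h.1])

theorem mem_iff_firstLetter_mem (w : CoprodI C) {W : Set (CoprodI C)} {j : Bool}
    (hW : ∀ γ, firstLetter j γ ≠ 1 → ∀ k (s : C k), γ ∈ W ↔ γ * CoprodI.of s ∈ W)
    (hw : firstLetter j w ≠ 1) : w ∈ W ↔ CoprodI.of (firstLetter j w) ∈ W := by
  induction w using reducedWord_induction generalizing W j with
  | one => exact absurd (firstLetter_one j) hw
  | mul i b w hb hwi ih =>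
    have hb' : firstLetter i (CoprodI.of b * w) = b := by rw [firstLetter_of_mul, hwi, mul_one]
    rcases Bool.eq_or_eq_not j i with rfl | rfl
    swap
    · exact absurd (firstLetter_not (hb'.trans_ne hb)) hw
    rw [hb']
    by_cases h1 : w = 1
    · rw [h1, mul_one]
    obtain ⟨i, hi⟩ := exists_firstLetter_ne_one h1
    rcases Bool.eq_or_eq_not i j with rfl | rfl
    · exact absurd hwi hi
    have hW' : ∀ γ, firstLetter j γ = 1 → ∀ k (s : C k),
        CoprodI.of b * γ ∈ W ↔ CoprodI.of b * (γ * CoprodI.of s) ∈ W := by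
      intro γ hγ k s
      rw [← mul_assoc]
      exact hW _ (by rwa [firstLetter_of_mul, hγ, mul_one]) k s
    have h2 := ih (W := {γ | CoprodI.of b * γ ∈ W}) (j := !j)
      (fun γ hγ k s => hW' γ (firstLetter_of_not hγ) k s) hi
    have h3 := hW' 1 (firstLetter_one j) _ (firstLetter (!j) w)
    rw [one_mul, mul_one] at h3
    exact h2.trans h3.symm

theorem mem_iff_mem_of_firstLetter_ne_one {W : Set (CoprodI C)} {j : Bool}
    (hW : ∀ γ, firstLetter j γ ≠ 1 → ∀ k (s : C k), γ ∈ W ↔ γ * CoprodI.of s ∈ W)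
    {w w' : CoprodI C} (hw : firstLetter j w ≠ 1) (hw' : firstLetter j w' ≠ 1) :
    w ∈ W ↔ w' ∈ W := by
  rw [mem_iff_firstLetter_mem w hW hw, mem_iff_firstLetter_mem w' hW hw']
  have h := hW (CoprodI.of (firstLetter j w)) (by
    rwa [← mul_one (CoprodI.of _), firstLetter_of_mul, firstLetter_one, mul_one]) j
    ((firstLetter j w)⁻¹ * firstLetter j w')
  rwa [← map_mul, mul_inv_cancel_left] at h

theorem infinite_coprodI [∀ i, Nontrivial (C i)] : Infinite (CoprodI C) := by
  by_contra h
  rw [not_infinite_iff_finite] at h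
  obtain ⟨γ, hγ⟩ := Finite.exists_max (syllableLength (C := C))
  have : ∃ i, firstLetter i γ = 1 := by
    by_cases h : firstLetter true γ = 1
    · exact ⟨_, h⟩
    · exact ⟨_, firstLetter_not h⟩
  obtain ⟨i, hi⟩ := this
  obtain ⟨a, ha⟩ := exists_ne (1 : C i)
  have := hγ (CoprodI.of a * γ)
  rw [syllableLength_of_mul ha hi] at this
  omega

end Words

section Cuts

variable {E : Type*}

/-- Two subsets cross if all four of their corners are nonempty. -/
def Crosses (A B : Set E) : Prop :=
  (A ∩ B).Nonempty ∧ (A ∩ Bᶜ).Nonempty ∧ (Aᶜ ∩ B).Nonempty ∧ (Aᶜ ∩ Bᶜ).Nonempty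

theorem crosses_compl_left {A B : Set E} : Crosses Aᶜ B ↔ Crosses A B := by
  simp only [Crosses, compl_compl]
  tauto

theorem crosses_compl_right {A B : Set E} : Crosses A Bᶜ ↔ Crosses A B := by
  simp only [Crosses, compl_compl]
  tauto

theorem Crosses.left_or_right {A B D : Set E} (hAB : Crosses A B) (h : Crosses D (A ∩ B)) :
    Crosses D A ∨ Crosses D B := by
  simp only [Crosses, Set.Nonempty, Set.mem_inter_iff, Set.mem_compl_iff] at *
  grind

theorem Crosses.left_or_right_of_union {A B D : Set E} (hAB : Crosses A B)
    (h : Crosses D (A ∪ B)) : Crosses D A ∨ Crosses D B := by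
  rw [← crosses_compl_right, Set.compl_union] at h
  simpa only [crosses_compl_right] using
    (crosses_compl_left.2 (crosses_compl_right.2 hAB)).left_or_right h

theorem crosses_of_inter_of_union {A B D : Set E} (h : Crosses D (A ∩ B))
    (h' : Crosses D (A ∪ B)) : Crosses D A := by
  obtain ⟨⟨x, hx⟩, -, ⟨z, hz⟩, -⟩ := h
  obtain ⟨-, ⟨y, hy⟩, -, ⟨w, hw⟩⟩ := h'
  exact ⟨⟨x, hx.1, hx.2.1⟩, ⟨y, hy.1, fun h => hy.2 (Or.inl h)⟩, ⟨z, hz.1, hz.2.1⟩,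
    ⟨w, hw.1, fun h => hw.2 (Or.inl h)⟩⟩

theorem not_crosses_inter (A B : Set E) : ¬ Crosses A (A ∩ B) := by
  rintro ⟨-, -, ⟨x, hx, hx'⟩, -⟩
  exact hx hx'.1

theorem not_crosses_union (A B : Set E) : ¬ Crosses A (A ∪ B) := by
  rintro ⟨-, ⟨x, hx, hx'⟩, -, -⟩
  exact hx' (Or.inl hx)

/-- A family of proper nonempty sets that is closed under complements and under taking corners
of crossing pairs. -/
structure IsUncrossing (F : Set (Set E)) : Prop where
  nonempty : ∀ A ∈ F, A.Nonempty
  compl : ∀ A ∈ F, Aᶜ ∈ F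
  inter : ∀ A ∈ F, ∀ B ∈ F, Crosses A B → A ∩ B ∈ F

variable {G : Type*} [Group G] [MulAction G E]

theorem crosses_smul_iff (g : G) {A B : Set E} : Crosses (g • A) (g • B) ↔ Crosses A B := by
  simp only [Crosses, ← Set.smul_set_compl, ← Set.smul_set_inter, Set.smul_set_nonempty]

theorem eq_smul_of_subset_smul {g : G} (hg : IsOfFinOrder g) {D : Set E} (h : D ⊆ g • D) :
    g • D = D := by
  have hpow : ∀ n : ℕ, D ⊆ g ^ n • D := by
    intro n
    induction n with
    | zero => simp
    | succ n ih =>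
      rw [pow_succ', mul_smul]
      exact h.trans (Set.smul_set_mono ih)
  refine subset_antisymm ?_ h
  calc g • D ⊆ g • (g ^ (orderOf g - 1) • D) := Set.smul_set_mono (hpow _)
    _ = D := by
      rw [← mul_smul, ← pow_succ', Nat.sub_add_cancel hg.orderOf_pos, pow_orderOf_eq_one, one_smul]

/-- An invariant Boolean algebra of sets in which every set crosses only finitely many
translates of any given set. -/
structure IsCutAlgebra (G : Type*) [Group G] [MulAction G E] (P : Set (Set E)) : Prop where
  compl : ∀ A ∈ P, Aᶜ ∈ P
  inter : ∀ A ∈ P, ∀ B ∈ P, A ∩ B ∈ P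
  smul : ∀ (g : G), ∀ A ∈ P, g • A ∈ P
  finite_crosses : ∀ A ∈ P, ∀ B ∈ P, {S ∈ MulAction.orbit G A | Crosses S B}.Finite

/-- The proper nonempty members of `P` which do not cross any of their translates. -/
def nestedCuts (G : Type*) [Group G] [MulAction G E] (P : Set (Set E)) : Set (Set E) :=
  {S | S ∈ P ∧ S.Nonempty ∧ Sᶜ.Nonempty ∧ ∀ g : G, ¬ Crosses S (g • S)}

variable {P : Set (Set E)}

theorem IsCutAlgebra.smul_mem_nestedCuts (hP : IsCutAlgebra G P) (g : G) {S : Set E}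
    (hS : S ∈ nestedCuts G P) : g • S ∈ nestedCuts G P := by
  refine ⟨hP.smul g S hS.1, hS.2.1.smul_set, ?_, fun k hk => ?_⟩
  · rw [← Set.smul_set_compl]
    exact hS.2.2.1.smul_set
  · rw [← crosses_smul_iff g⁻¹, inv_smul_smul, ← mul_smul, ← mul_smul] at hk
    exact hS.2.2.2 _ hk

theorem IsCutAlgebra.union (hP : IsCutAlgebra G P) {A B : Set E} (hA : A ∈ P) (hB : B ∈ P) :
    A ∪ B ∈ P := by
  have := hP.compl _ (hP.inter _ (hP.compl _ hA) _ (hP.compl _ hB))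
  simpa [Set.compl_inter] using this

/-- The number of translates of `H` crossing `D`. -/
noncomputable def crossingNumber (G : Type*) [Group G] [MulAction G E] (H D : Set E) : ℕ :=
  {S ∈ MulAction.orbit G H | Crosses S D}.ncard

theorem crossingNumber_compl (H D : Set E) : crossingNumber G H Dᶜ = crossingNumber G H D := by
  simp only [crossingNumber, crosses_compl_right]

theorem crossingNumber_smul (H D : Set E) (g : G) :
    crossingNumber G H (g • D) = crossingNumber G H D := by
  have : {S ∈ MulAction.orbit G H | Crosses S (g • D)} =
      (fun S => g • S) '' {S ∈ MulAction.orbit G H | Crosses S D} := by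
    ext S
    constructor
    · rintro ⟨hS, hc⟩
      refine ⟨g⁻¹ • S, ⟨MulAction.mem_orbit_of_mem_orbit _ hS, ?_⟩, smul_inv_smul g S⟩
      rwa [← crosses_smul_iff g, smul_inv_smul]
    · rintro ⟨S, ⟨hS, hc⟩, rfl⟩
      exact ⟨MulAction.mem_orbit_of_mem_orbit _ hS, (crosses_smul_iff g).2 hc⟩
  rw [crossingNumber, this, Set.ncard_image_of_injective _ (MulAction.injective g), crossingNumber]

theorem IsCutAlgebra.crossingNumber_add_le (hP : IsCutAlgebra G P) {H A B : Set E} (hH : H ∈ P)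
    (hA : A ∈ P) (hB : B ∈ P) (h : Crosses A B) :
    crossingNumber G H (A ∩ B) + crossingNumber G H (A ∪ B) ≤
      crossingNumber G H A + crossingNumber G H B := by
  have fin := fun D hD => hP.finite_crosses H hH D hD
  unfold crossingNumber
  rw [← Set.ncard_union_add_ncard_inter _ _ (fin _ (hP.inter _ hA _ hB)) (fin _ (hP.union hA hB)),
    ← Set.ncard_union_add_ncard_inter _ _ (fin _ hA) (fin _ hB)]
  refine add_le_add (Set.ncard_le_ncard ?_ ((fin _ hA).union (fin _ hB)))
    (Set.ncard_le_ncard ?_ ((fin _ hA).inter_of_left _))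
  · rintro S (⟨hS, hc⟩ | ⟨hS, hc⟩)
    · exact (h.left_or_right hc).imp (⟨hS, ·⟩) (⟨hS, ·⟩)
    · exact (h.left_or_right_of_union hc).imp (⟨hS, ·⟩) (⟨hS, ·⟩)
  · rintro S ⟨⟨hS, hc⟩, -, hc'⟩
    refine ⟨⟨hS, crosses_of_inter_of_union hc hc'⟩, hS, ?_⟩
    rw [Set.inter_comm] at hc
    rw [Set.union_comm] at hc'
    exact crosses_of_inter_of_union hc hc'

theorem IsCutAlgebra.crossingNumber_add_lt (hP : IsCutAlgebra G P) {H B : Set E} (hH : H ∈ P)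
    (hB : B ∈ P) (h : Crosses H B) :
    crossingNumber G H (H ∩ B) + crossingNumber G H (H ∪ B) <
      crossingNumber G H H + crossingNumber G H B := by
  have fin := fun D hD => hP.finite_crosses H hH D hD
  unfold crossingNumber
  rw [← Set.ncard_union_add_ncard_inter _ _ (fin _ (hP.inter _ hH _ hB)) (fin _ (hP.union hH hB)),
    ← Set.ncard_union_add_ncard_inter _ _ (fin _ hH) (fin _ hB)]
  refine add_lt_add_of_lt_of_le (Set.ncard_lt_ncard ?_ ((fin _ hH).union (fin _ hB)))
    (Set.ncard_le_ncard ?_ ((fin _ hH).inter_of_left _))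
  · refine (Set.ssubset_iff_of_subset ?_).2 ⟨H, Or.inr ⟨MulAction.mem_orbit_self H, h⟩, ?_⟩
    · rintro S (⟨hS, hc⟩ | ⟨hS, hc⟩)
      · exact (h.left_or_right hc).imp (⟨hS, ·⟩) (⟨hS, ·⟩)
      · exact (h.left_or_right_of_union hc).imp (⟨hS, ·⟩) (⟨hS, ·⟩)
    · rintro (⟨-, hc⟩ | ⟨-, hc⟩)
      · exact not_crosses_inter _ _ hc
      · exact not_crosses_union _ _ hc
  · rintro S ⟨⟨hS, hc⟩, -, hc'⟩
    refine ⟨⟨hS, crosses_of_inter_of_union hc hc'⟩, hS, ?_⟩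
    rw [Set.inter_comm] at hc
    rw [Set.union_comm] at hc'
    exact crosses_of_inter_of_union hc hc'

end Cuts

section Branching

open Monoid

variable {E G : Type*} [Group G] [MulAction G E] {C : Bool → Type} [∀ i, Group (C i)]

/-- The half-space of points whose `i`-th coordinate is nontrivial. -/
def halfSpace (κ : ∀ i, E → C i) (i : Bool) : Set E := {x | κ i x ≠ 1}

/-- `D` is constant on the branches at distance `n` inside the half-space of index `i`. -/
def ConstantAtDepth (φ : CoprodI C →* G) (κ : ∀ i, E → C i) : ℕ → Bool → Set E → Prop
  | 0, i, D => ∀ x y, κ i x ≠ 1 → κ i y ≠ 1 → (x ∈ D ↔ y ∈ D)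
  | n + 1, i, D => ∀ a : C i, a ≠ 1 →
      ConstantAtDepth φ κ n (!i) ((φ (CoprodI.of a))⁻¹ • D)

/-- Coordinates on a set acted on by a free product, modelled on the ends of its Bass–Serre tree:
`κ i x` records the branch at the vertex fixed by the factor `i` which contains `x`. -/
structure IsBranching (P : Set (Set E)) (φ : CoprodI C →* G) (κ : ∀ i, E → C i) : Prop where
  of_smul : ∀ i (a : C i) x, κ i (φ (CoprodI.of a) • x) = a * κ i x
  eq_one_iff : ∀ i x, κ i x = 1 ↔ κ (!i) x ≠ 1
  halfSpace_mem : ∀ i, halfSpace κ i ∈ P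
  constantAtDepth : ∀ D ∈ P, ∃ n, ∀ i, ConstantAtDepth φ κ n i D

variable {P F : Set (Set E)} {φ : CoprodI C →* G} {κ : ∀ i, E → C i}

theorem IsBranching.inv_of_smul (h : IsBranching P φ κ) (i : Bool) (a : C i) (x : E) :
    κ i ((φ (CoprodI.of a))⁻¹ • x) = a⁻¹ * κ i x := by
  rw [← map_inv, ← map_inv, h.of_smul]

theorem IsBranching.surjective (h : IsBranching P φ κ) [Nonempty E] (i : Bool) :
    Function.Surjective (κ i) := by
  intro c
  obtain ⟨x⟩ := ‹Nonempty E›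
  exact ⟨φ (CoprodI.of (c * (κ i x)⁻¹)) • x, by rw [h.of_smul, inv_mul_cancel_right]⟩

theorem IsBranching.halfSpace_not (h : IsBranching P φ κ) (i : Bool) :
    halfSpace κ (!i) = (halfSpace κ i)ᶜ := by
  ext x
  simp [halfSpace, h.eq_one_iff i]

/-- An uncrossing family containing a set which is constant on all branches but one at a vertex,
and not on their union, contains a union of branches at that vertex. -/
theorem IsBranching.exists_saturated (h : IsBranching P φ κ) [∀ i, Finite (C i)]
    (hF : IsUncrossing F) (hinv : ∀ γ, ∀ A ∈ F, φ γ • A ∈ F) {D : Set E} (hDF : D ∈ F) {i : Bool}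
    (hD : ∀ x y, κ i x = κ i y → κ i x ≠ 1 → (x ∈ D ↔ y ∈ D))
    (hne : ∃ x y, κ i x ≠ 1 ∧ κ i y ≠ 1 ∧ x ∈ D ∧ y ∉ D) :
    ∃ A ∈ F, ∀ x y, κ i x = κ i y → (x ∈ A ↔ y ∈ A) := by
  by_contra! hno
  obtain ⟨x₁, y₁, hx₁, hy₁, hx₁D, hy₁D⟩ :
      ∃ x y, κ i x = 1 ∧ κ i y = 1 ∧ x ∈ D ∧ y ∉ D := by
    obtain ⟨x, y, hxy, hc⟩ := hno D hDF
    have hx : κ i x = 1 := by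
      by_contra hx
      have := hD x y hxy hx
      tauto
    rcases hc with hc | hc
    · exact ⟨x, y, hx, hxy ▸ hx, hc⟩
    · exact ⟨y, x, hxy ▸ hx, hx, hc.2, hc.1⟩
  set T : C i → Set E := fun t => φ (CoprodI.of t) • D with hT
  have hmem : ∀ t x, x ∈ T t ↔ (φ (CoprodI.of t))⁻¹ • x ∈ D := fun t x =>
    Set.mem_smul_set_iff_inv_smul_mem
  have hsat : ∀ t x y, κ i x = κ i y → κ i x ≠ t → (x ∈ T t ↔ y ∈ T t) := by
    intro t x y hxy hx
    rw [hmem, hmem]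
    refine hD _ _ ?_ ?_
    · rw [h.inv_of_smul, h.inv_of_smul, hxy]
    · rwa [h.inv_of_smul, Ne, inv_mul_eq_one, eq_comm]
  have key : ∀ t, t ≠ 1 → ∀ A ∈ F, ∀ B ∈ F, Crosses A B → (∀ x, κ i x = t → x ∉ A) →
      (∀ x, κ i x = 1 → x ∉ B) → (∀ x y, κ i x = κ i y → κ i x ≠ 1 → (x ∈ A ↔ y ∈ A)) →
      (∀ x y, κ i x = κ i y → κ i x ≠ t → (x ∈ B ↔ y ∈ B)) → False := by
    intro t ht A hA B hB hc hAt hB1 hAs hBs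
    obtain ⟨x, y, hxy, hxy'⟩ := hno _ (hF.inter A hA B hB hc)
    have hiff : x ∈ A ∩ B ↔ y ∈ A ∩ B := by
      by_cases hx1 : κ i x = 1
      · exact iff_of_false (fun hx => hB1 x hx1 hx.2) (fun hy => hB1 y (hxy ▸ hx1) hy.2)
      by_cases hxt : κ i x = t
      · exact iff_of_false (fun hx => hAt x hxt hx.1) (fun hy => hAt y (hxy ▸ hxt) hy.1)
      · exact and_congr (hAs x y hxy hx1) (hBs x y hxy hxt)
    tauto
  have hcompl : ∀ (A : Set E) (t : C i),
      (∀ x y, κ i x = κ i y → κ i x ≠ t → (x ∈ A ↔ y ∈ A)) →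
      ∀ x y, κ i x = κ i y → κ i x ≠ t → (x ∈ Aᶜ ↔ y ∈ Aᶜ) :=
    fun A t hA x y hxy hx => not_congr (hA x y hxy hx)
  have hside : ∀ (A : Set E) (s t : C i), s ≠ t →
      (∀ x y, κ i x = κ i y → κ i x ≠ t → (x ∈ A ↔ y ∈ A)) →
      (∀ x, κ i x = s → x ∉ A) ∨ ∀ x, κ i x = s → x ∉ Aᶜ := by
    intro A s t hst hA
    by_contra! hc
    obtain ⟨⟨x, hx, hxA⟩, y, hy, hyA⟩ := hc
    exact hyA ((hA x y (hx.trans hy.symm) (hx ▸ hst)).1 hxA)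
  have hnc : ∀ t, t ≠ 1 → ¬ Crosses D (T t) := by
    intro t ht hc
    have hTF : T t ∈ F := hinv _ _ hDF
    rcases hside D t 1 ht hD with h1 | h1 <;> rcases hside (T t) 1 t ht.symm (hsat t) with h2 | h2
    · exact key t ht _ hDF _ hTF hc h1 h2 hD (hsat t)
    · exact key t ht _ hDF _ (hF.compl _ hTF) (crosses_compl_right.2 hc) h1 h2 hD
        (hcompl _ _ (hsat t))
    · exact key t ht _ (hF.compl _ hDF) _ hTF (crosses_compl_left.2 hc) h1 h2 (hcompl _ _ hD)
        (hsat t)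
    · exact key t ht _ (hF.compl _ hDF) _ (hF.compl _ hTF)
        (crosses_compl_left.2 (crosses_compl_right.2 hc)) h1 h2 (hcompl _ _ hD)
        (hcompl _ _ (hsat t))
  have hneq : ∀ t, t ≠ 1 → T t ≠ D := by
    intro t ht he
    have := hsat t x₁ y₁ (hx₁.trans hy₁.symm) (hx₁ ▸ ht.symm)
    rw [he] at this
    exact hy₁D (this.1 hx₁D)
  have hfin : ∀ t : C i, IsOfFinOrder (φ (CoprodI.of t)) := fun t =>
    (φ.comp CoprodI.of).isOfFinOrder (isOfFinOrder_of_finite t)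
  have hsub : ∀ t, t ≠ 1 → ¬ D ⊆ T t := fun t ht hs =>
    hneq t ht (eq_smul_of_subset_smul (hfin t) hs)
  have hsub' : ∀ t, t ≠ 1 → ¬ T t ⊆ D := by
    intro t ht hs
    refine hsub t⁻¹ (inv_ne_one.2 ht) ?_
    simp only [hT, map_inv]
    exact Set.subset_smul_set_iff.2 (by rwa [inv_inv])
  have halt : ∀ t, t ≠ 1 → D ∩ T t = ∅ ∨ Dᶜ ∩ (T t)ᶜ = ∅ := by
    intro t ht
    by_contra! hc
    refine hnc t ht ⟨hc.1, ?_, ?_, hc.2⟩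
    · obtain ⟨x, hx, hx'⟩ := Set.not_subset.1 (hsub t ht)
      exact ⟨x, hx, hx'⟩
    · obtain ⟨x, hx, hx'⟩ := Set.not_subset.1 (hsub' t ht)
      exact ⟨x, hx', hx⟩
  obtain ⟨u, v, hu, hv, huD, hvD⟩ := hne
  have hu1 : (κ i u)⁻¹ ≠ 1 := inv_ne_one.2 hu
  have hv1 : (κ i v)⁻¹ ≠ 1 := inv_ne_one.2 hv
  have hbase : ∀ w x, κ i w ≠ 1 → κ i x = 1 → (x ∈ T (κ i w)⁻¹ ↔ w ∈ D) := by
    intro w x hw hx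
    rw [hmem]
    have : κ i ((φ (CoprodI.of (κ i w)⁻¹))⁻¹ • x) = κ i w := by
      rw [h.inv_of_smul, hx, inv_inv, mul_one]
    exact hD _ _ this (this.trans_ne hw)
  have h1 : Dᶜ ∩ (T (κ i u)⁻¹)ᶜ = ∅ := (halt _ hu1).resolve_left fun he => by
    have : x₁ ∈ D ∩ T (κ i u)⁻¹ := ⟨hx₁D, (hbase u x₁ hu hx₁).2 huD⟩
    rw [he] at this
    exact this
  have h2 : D ∩ T (κ i v)⁻¹ = ∅ := (halt _ hv1).resolve_right fun he => by
    have : y₁ ∈ Dᶜ ∩ (T (κ i v)⁻¹)ᶜ := ⟨hy₁D, fun hc => hvD ((hbase v y₁ hv hy₁).1 hc)⟩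
    rw [he] at this
    exact this
  have h3 : T (κ i v)⁻¹ ⊆ T (κ i u)⁻¹ := by
    intro x hx
    by_contra hxu
    have hxD : x ∉ D := fun hxD => by
      have : x ∈ D ∩ T (κ i v)⁻¹ := ⟨hxD, hx⟩
      rw [h2] at this
      exact this
    have : x ∈ Dᶜ ∩ (T (κ i u)⁻¹)ᶜ := ⟨hxD, hxu⟩
    rw [h1] at this
    exact this
  have huv : κ i v * (κ i u)⁻¹ ≠ 1 := by
    intro he
    have he : κ i v = κ i u := mul_inv_eq_one.1 he
    exact hvD ((hD u v he.symm hu).1 huD)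
  refine hsub _ huv ?_
  have h4 := Set.smul_set_mono (a := φ (CoprodI.of (κ i v))) h3
  simp only [hT, ← mul_smul, ← map_mul, mul_inv_cancel, map_one, one_smul] at h4
  exact h4

/-- An uncrossing family containing a union of branches at a vertex of prime valence contains a
half-space. -/
theorem IsBranching.halfSpace_mem_of_saturated (h : IsBranching P φ κ) [Nonempty E]
    (hprime : ∀ i, (Nat.card (C i)).Prime)
    (hF : IsUncrossing F) (hinv : ∀ γ, ∀ A ∈ F, φ γ • A ∈ F) {i : Bool} {A : Set E} (hA : A ∈ F)
    (hsat : ∀ x y, κ i x = κ i y → (x ∈ A ↔ y ∈ A)) : halfSpace κ (!i) ∈ F := by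
  have : Finite (C i) := Nat.finite_of_card_ne_zero (hprime i).ne_zero
  have hsurj := h.surjective i
  have hmain : ∃ I : Set (C i), κ i ⁻¹' I ∈ F := by
    refine ⟨κ i '' A, ?_⟩
    convert hA
    ext x
    constructor
    · rintro ⟨y, hy, hyx⟩
      exact (hsat y x hyx).1 hy
    · exact fun hx => ⟨x, hx, rfl⟩
  obtain ⟨I, hI, hmin⟩ := (measure (fun I : Set (C i) => I.ncard)).wf.has_min
    {I | κ i ⁻¹' I ∈ F} hmain
  have hmin : ∀ J : Set (C i), κ i ⁻¹' J ∈ F → I.ncard ≤ J.ncard := fun J hJ =>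
    not_lt.1 (hmin J hJ)
  have hI' : κ i ⁻¹' I ∈ F := hI
  have hsmul : ∀ (t : C i) (J : Set (C i)),
      φ (CoprodI.of t) • (κ i ⁻¹' J) = κ i ⁻¹' (t • J) := by
    intro t J
    ext x
    rw [Set.mem_smul_set_iff_inv_smul_mem, Set.mem_preimage, Set.mem_preimage, h.inv_of_smul,
      Set.mem_smul_set_iff_inv_smul_mem, smul_eq_mul]
  have hIc : I.ncard ≤ Iᶜ.ncard := hmin _ (hF.compl _ hI')
  have hcard := Set.ncard_add_ncard_compl I
  obtain ⟨x, hx⟩ : I.Nonempty := by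
    obtain ⟨x, hx⟩ := hF.nonempty _ hI'
    exact ⟨_, hx⟩
  have hone : I = {x} := by
    by_contra hne
    obtain ⟨y, hy, hyx⟩ : ∃ y ∈ I, y ≠ x := by
      by_contra! hc
      exact hne (Set.eq_singleton_iff_unique_mem.2 ⟨hx, hc⟩)
    set t := y * x⁻¹
    have ht1 : t ≠ 1 := fun h => hyx (mul_inv_eq_one.1 h)
    have htx : t * x = y := by simp [t]
    have hyt : y ∈ t • I := ⟨x, hx, htx⟩
    have hcardt : (t • I).ncard = I.ncard := Set.ncard_smul_set t I
    have hIpos : 0 < I.ncard := (Set.ncard_pos).2 ⟨x, hx⟩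
    have htI : t • I ≠ I := by
      intro he
      have hstab : t ∈ MulAction.stabilizer (C i) I := he
      have htop : Subgroup.zpowers t = ⊤ := by
        have := Fact.mk (hprime i)
        exact zpowers_eq_top_of_prime_card rfl ht1
      have hall : ∀ c : C i, c ∈ I := by
        intro c
        have hc : c * x⁻¹ ∈ Subgroup.zpowers t := htop ▸ Subgroup.mem_top _
        have := (Subgroup.zpowers_le.2 hstab) hc
        have h2 : (c * x⁻¹) • I = I := this
        rw [← h2]
        exact ⟨x, hx, by simp⟩
      have : Iᶜ = ∅ := by
        ext c
        simp [hall c]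
      rw [this, Set.ncard_empty] at hIc
      omega
    have hnot1 : ¬ I ⊆ t • I := fun hs =>
      htI (Set.eq_of_subset_of_ncard_le hs hcardt.le).symm
    have hnot2 : ¬ t • I ⊆ I := fun hs => htI (Set.eq_of_subset_of_ncard_le hs hcardt.ge)
    have hcross : Crosses (κ i ⁻¹' I) (κ i ⁻¹' (t • I)) := by
      refine ⟨?_, ?_, ?_, ?_⟩
      · obtain ⟨z, hz⟩ := hsurj y
        exact ⟨z, by simpa [hz] using hy, by simpa [hz] using hyt⟩
      · obtain ⟨c, hc, hc'⟩ := Set.not_subset.1 hnot1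
        obtain ⟨z, rfl⟩ := hsurj c
        exact ⟨z, hc, hc'⟩
      · obtain ⟨c, hc, hc'⟩ := Set.not_subset.1 hnot2
        obtain ⟨z, rfl⟩ := hsurj c
        exact ⟨z, hc', hc⟩
      · have hu : I ∪ t • I ≠ Set.univ := by
          intro he
          have h1 := Set.ncard_union_add_ncard_inter I (t • I)
          rw [he, Set.ncard_univ] at h1
          have h2 : 0 < (I ∩ t • I).ncard := (Set.ncard_pos).2 ⟨y, hy, hyt⟩
          omega
        obtain ⟨c, hc⟩ := (Set.ne_univ_iff_exists_notMem _).1 hu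
        obtain ⟨z, rfl⟩ := hsurj c
        exact ⟨z, fun hz => hc (Or.inl hz), fun hz => hc (Or.inr hz)⟩
    have hcorner : κ i ⁻¹' (I ∩ t • I) ∈ F := by
      have h0 := hinv (CoprodI.of t) _ hI'
      rw [hsmul] at h0
      exact hF.inter _ hI' _ h0 hcross
    have := hmin _ hcorner
    have hlt : (I ∩ t • I).ncard < I.ncard := by
      refine Set.ncard_lt_ncard ⟨Set.inter_subset_left, fun hs => hnot1 ?_⟩
      exact hs.trans Set.inter_subset_right
    omega
  have h1 := hinv (CoprodI.of x⁻¹) _ hI'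
  rw [hsmul, hone, Set.smul_set_singleton, smul_eq_mul, inv_mul_cancel] at h1
  convert h1
  ext z
  simp [halfSpace, h.eq_one_iff i]

theorem IsBranching.exists_vertex (h : IsBranching P φ κ) (n : ℕ) {i : Bool} {D : Set E}
    (hD : ConstantAtDepth φ κ n i D) (hne : ∃ x y, κ i x ≠ 1 ∧ κ i y ≠ 1 ∧ x ∈ D ∧ y ∉ D) :
    ∃ (γ : CoprodI C) (j : Bool),
      (∀ x y, κ j x = κ j y → κ j x ≠ 1 → (x ∈ φ γ • D ↔ y ∈ φ γ • D)) ∧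
      ∃ x y, κ j x ≠ 1 ∧ κ j y ≠ 1 ∧ x ∈ φ γ • D ∧ y ∉ φ γ • D := by
  induction n generalizing i D with
  | zero =>
    obtain ⟨x, y, hx, hy, hxD, hyD⟩ := hne
    exact absurd ((hD x y hx hy).1 hxD) hyD
  | succ n ih =>
    by_cases hc : ∃ a : C i, a ≠ 1 ∧ ∃ x y, κ (!i) x ≠ 1 ∧ κ (!i) y ≠ 1 ∧
        x ∈ (φ (CoprodI.of a))⁻¹ • D ∧ y ∉ (φ (CoprodI.of a))⁻¹ • D
    · obtain ⟨a, ha, hne'⟩ := hc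
      obtain ⟨γ, j, hγ⟩ := ih (hD a ha) hne'
      refine ⟨γ * (CoprodI.of a)⁻¹, j, ?_⟩
      rwa [map_mul, map_inv, mul_smul]
    · push Not at hc
      refine ⟨1, i, ?_, ?_⟩
      swap
      · simpa using hne
      have key : ∀ x y, κ i x = κ i y → κ i x ≠ 1 → x ∈ D → y ∈ D := by
        intro x y hxy hx hxD
        have hpt : ∀ z, κ i z = κ i x → κ (!i) ((φ (CoprodI.of (κ i x)))⁻¹ • z) ≠ 1 := by
          intro z hz
          rw [← h.eq_one_iff, h.inv_of_smul, hz, inv_mul_cancel]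
        have := hc (κ i x) hx _ _ (hpt x rfl) (hpt y hxy.symm)
        simpa [Set.mem_inv_smul_set_iff, hxD] using this
      intro x y hxy hx
      simp only [map_one, one_smul]
      exact ⟨key x y hxy hx, key y x hxy.symm (hxy ▸ hx)⟩

theorem IsBranching.halfSpace_mem_of_isUncrossing (h : IsBranching P φ κ) [Nonempty E]
    (hprime : ∀ i, (Nat.card (C i)).Prime)
    (hF : IsUncrossing F) (hinv : ∀ γ, ∀ A ∈ F, φ γ • A ∈ F) (hFP : F ⊆ P) (hne : F.Nonempty)
    (i : Bool) : halfSpace κ i ∈ F := by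
  have hfin : ∀ i, Finite (C i) := fun i => Nat.finite_of_card_ne_zero (hprime i).ne_zero
  suffices hs : ∃ j, halfSpace κ j ∈ F by
    obtain ⟨j, hj⟩ := hs
    rcases Bool.eq_or_eq_not i j with rfl | rfl
    · exact hj
    · rw [h.halfSpace_not]
      exact hF.compl _ hj
  obtain ⟨D, hD⟩ := hne
  obtain ⟨n, hn⟩ := h.constantAtDepth D (hFP hD)
  by_cases hc : ∃ i x y, κ i x ≠ 1 ∧ κ i y ≠ 1 ∧ x ∈ D ∧ y ∉ D
  · obtain ⟨i, hc⟩ := hc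
    obtain ⟨γ, j, hγ, hγ'⟩ := h.exists_vertex n (hn i) hc
    obtain ⟨A, hA, hsat⟩ := h.exists_saturated hF hinv (hinv γ D hD) hγ hγ'
    exact ⟨_, h.halfSpace_mem_of_saturated hprime hF hinv hA hsat⟩
  · push Not at hc
    obtain ⟨x, hx⟩ := hF.nonempty _ hD
    obtain ⟨y, hy⟩ := hF.nonempty _ (hF.compl _ hD)
    obtain ⟨j, hj⟩ : ∃ j, κ j x ≠ 1 := by
      by_cases h1 : κ true x = 1
      · exact ⟨_, (h.eq_one_iff true x).1 h1⟩
      · exact ⟨_, h1⟩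
    refine ⟨j, ?_⟩
    convert hD
    ext z
    constructor
    · exact fun hz => hc j x z hj hz hx
    · intro hz hz1
      have hyj : κ j y = 1 := by
        by_contra hyj
        exact hy (hc j x y hj hyj hx)
      exact hy (hc (!j) z y ((h.eq_one_iff j z).1 hz1) ((h.eq_one_iff j y).1 hyj) hz)

end Branching

section Counting

open Monoid

variable {E G : Type*} [Group G] [MulAction G E] {C : Bool → Type} [∀ i, Group (C i)]
  {P : Set (Set E)} {φ : CoprodI C →* G} {κ : ∀ i, E → C i}

theorem IsBranching.halfSpace_nonempty (h : IsBranching P φ κ) [Nonempty E]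
    [∀ i, Nontrivial (C i)] (i : Bool) : (halfSpace κ i).Nonempty := by
  obtain ⟨a, ha⟩ := exists_ne (1 : C i)
  obtain ⟨x, rfl⟩ := h.surjective i a
  exact ⟨x, ha⟩

theorem IsBranching.of_smul_halfSpace_not (h : IsBranching P φ κ) (i : Bool) (a : C i) :
    φ (CoprodI.of a) • halfSpace κ (!i) = {x | κ i x = a} := by
  ext x
  rw [Set.mem_smul_set_iff_inv_smul_mem, halfSpace, Set.mem_ofPred_eq, ← h.eq_one_iff,
    h.inv_of_smul, inv_mul_eq_one, eq_comm, Set.mem_ofPred_eq]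

/-- The half-spaces of a branching structure do not cross their translates: they minimise the
crossing number. -/
theorem IsBranching.halfSpace_mem_nestedCuts (h : IsBranching P φ κ) (hP : IsCutAlgebra G P)
    [Nonempty E] (hprime : ∀ i, (Nat.card (C i)).Prime) (i : Bool) :
    halfSpace κ i ∈ nestedCuts G P := by
  have : ∀ i, Finite (C i) := fun i => Nat.finite_of_card_ne_zero (hprime i).ne_zero
  have : ∀ i, Nontrivial (C i) := fun i => Finite.one_lt_card_iff_nontrivial.1 (hprime i).one_lt
  set H := halfSpace κ i
  have hHc : Hᶜ.Nonempty := by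
    rw [← h.halfSpace_not]
    exact h.halfSpace_nonempty _
  obtain ⟨D, ⟨hDP, hD, hDc⟩, hmin⟩ := (measure (crossingNumber G H)).wf.has_min
    {D | D ∈ P ∧ D.Nonempty ∧ Dᶜ.Nonempty} ⟨H, h.halfSpace_mem i, h.halfSpace_nonempty i, hHc⟩
  have hmin : ∀ B ∈ P, B.Nonempty → Bᶜ.Nonempty →
      crossingNumber G H D ≤ crossingNumber G H B := fun B hB h1 h2 =>
    not_lt.1 (hmin B ⟨hB, h1, h2⟩)
  have hcorner : ∀ A ∈ P, ∀ B ∈ P, Crosses A B →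
      crossingNumber G H D ≤ crossingNumber G H (A ∩ B) ∧
      crossingNumber G H D ≤ crossingNumber G H (A ∪ B) := by
    rintro A hA B hB ⟨h1, h2, h3, h4⟩
    refine ⟨hmin _ (hP.inter _ hA _ hB) h1 ?_, hmin _ (hP.union hA hB) ?_ ?_⟩
    · exact h4.mono fun x hx hx' => hx.1 hx'.1
    · exact h1.mono fun x hx => Or.inl hx.1
    · rwa [Set.compl_union]
  set F := {B | B ∈ P ∧ B.Nonempty ∧ Bᶜ.Nonempty ∧ crossingNumber G H B = crossingNumber G H D}
  have hF : IsUncrossing F := by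
    refine ⟨fun A hA => hA.2.1, fun A hA => ?_, fun A hA B hB hc => ?_⟩
    · exact ⟨hP.compl _ hA.1, hA.2.2.1, by simpa using hA.2.1,
        (crossingNumber_compl H A).trans hA.2.2.2⟩
    · have h1 := hcorner A hA.1 B hB.1 hc
      have h2 : crossingNumber G H (A ∩ B) + crossingNumber G H (A ∪ B) ≤
          crossingNumber G H A + crossingNumber G H B :=
        hP.crossingNumber_add_le (h.halfSpace_mem i) hA.1 hB.1 hc
      have hA' := hA.2.2.2
      have hB' := hB.2.2.2
      refine ⟨hP.inter _ hA.1 _ hB.1, hc.1, hc.2.2.2.mono fun x hx hx' => hx.1 hx'.1, ?_⟩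
      omega
  have hinv : ∀ g : G, ∀ A ∈ F, g • A ∈ F := by
    rintro g A ⟨hA, h1, h2, h3⟩
    exact ⟨hP.smul g A hA, h1.smul_set, by simpa [← Set.smul_set_compl] using h2,
      (crossingNumber_smul H A g).trans h3⟩
  have hHF : H ∈ F := h.halfSpace_mem_of_isUncrossing hprime hF (fun γ => hinv _)
    (fun A hA => hA.1) ⟨D, hDP, hD, hDc, rfl⟩ i
  refine ⟨hHF.1, hHF.2.1, hHF.2.2.1, fun g hc => ?_⟩
  have h1 := hcorner _ hHF.1 _ (hinv g _ hHF).1 hc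
  have h2 := hP.crossingNumber_add_lt hHF.1 (hinv g _ hHF).1 hc
  have h3 := hHF.2.2.2
  have h4 := (hinv g _ hHF).2.2.2
  omega

theorem IsBranching.exists_eq_smul_halfSpace (h : IsBranching P φ κ) (hP : IsCutAlgebra G P)
    [Nonempty E] (hprime : ∀ i, (Nat.card (C i)).Prime) {S : Set E} (hS : S ∈ nestedCuts G P) :
    ∃ γ i, S = φ γ • halfSpace κ i := by
  have hnc : ∀ g k : G, ¬ Crosses (g • S) (k • S) := by
    intro g k hc
    rw [← crosses_smul_iff g⁻¹, inv_smul_smul, ← mul_smul] at hc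
    exact hS.2.2.2 _ hc
  have hF : IsUncrossing {A | ∃ γ, A = φ γ • S ∨ A = φ γ • Sᶜ} := by
    refine ⟨?_, ?_, ?_⟩
    · rintro A ⟨γ, rfl | rfl⟩
      · exact hS.2.1.smul_set
      · exact hS.2.2.1.smul_set
    · rintro A ⟨γ, rfl | rfl⟩
      · exact ⟨γ, Or.inr Set.smul_set_compl.symm⟩
      · exact ⟨γ, Or.inl (by rw [← Set.smul_set_compl, compl_compl])⟩
    · rintro A ⟨γ, hA⟩ B ⟨δ, hB⟩ hc
      exfalso
      apply hnc (φ γ) (φ δ)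
      rcases hA with rfl | rfl <;> rcases hB with rfl | rfl <;>
        simpa only [Set.smul_set_compl, crosses_compl_left, crosses_compl_right] using hc
  have hinv : ∀ γ, ∀ A ∈ {A | ∃ γ, A = φ γ • S ∨ A = φ γ • Sᶜ},
      φ γ • A ∈ {A | ∃ γ, A = φ γ • S ∨ A = φ γ • Sᶜ} := by
    rintro γ A ⟨δ, rfl | rfl⟩
    · exact ⟨γ * δ, Or.inl (by rw [map_mul, mul_smul])⟩
    · exact ⟨γ * δ, Or.inr (by rw [map_mul, mul_smul])⟩
  have hsub : {A | ∃ γ, A = φ γ • S ∨ A = φ γ • Sᶜ} ⊆ P := by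
    rintro A ⟨δ, rfl | rfl⟩
    · exact hP.smul _ _ hS.1
    · exact hP.smul _ _ (hP.compl _ hS.1)
  obtain ⟨γ, hγ | hγ⟩ := h.halfSpace_mem_of_isUncrossing hprime hF hinv hsub
    ⟨S, 1, Or.inl (by simp)⟩ true
  · exact ⟨γ⁻¹, true, by rw [hγ, map_inv, inv_smul_smul]⟩
  · refine ⟨γ⁻¹, false, ?_⟩
    rw [show false = !true from rfl, h.halfSpace_not, hγ, map_inv, Set.smul_set_compl,
      inv_smul_smul, compl_compl]

theorem IsBranching.smul_halfSpace_subset (h : IsBranching P φ κ) (γ : CoprodI C) {i : Bool}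
    (hγ : firstLetter i γ = 1) (k : Bool) :
    φ γ • halfSpace κ k ⊆ halfSpace κ (!i) ∨ φ γ • (halfSpace κ k)ᶜ ⊆ halfSpace κ (!i) := by
  induction γ using reducedWord_induction generalizing i k with
  | one =>
    rw [map_one, one_smul, one_smul]
    rcases Bool.eq_or_eq_not k i with rfl | rfl
    · rw [h.halfSpace_not]
      exact Or.inr subset_rfl
    · exact Or.inl subset_rfl
  | mul j b w hb hw ih =>
    obtain rfl : i = !j := by
      rcases Bool.eq_or_eq_not i j with rfl | rfl
      · rw [firstLetter_of_mul, hw, mul_one] at hγ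
        exact absurd hγ hb
      · rfl
    have hsub : φ (CoprodI.of b) • halfSpace κ (!j) ⊆ halfSpace κ (!!j) := by
      rw [h.of_smul_halfSpace_not, Bool.not_not]
      intro x hx hx1
      exact hb (hx.symm.trans hx1)
    rw [map_mul, mul_smul, mul_smul]
    exact (ih hw k).imp (fun hs => (Set.smul_set_mono hs).trans hsub)
      (fun hs => (Set.smul_set_mono hs).trans hsub)

/-- A translate of a half-space is a half-space or lies, up to complement, in a branch. -/
theorem IsBranching.subset_branch_of_mem_nestedCuts (h : IsBranching P φ κ)
    (hP : IsCutAlgebra G P) [Nonempty E] (hprime : ∀ i, (Nat.card (C i)).Prime) {S : Set E}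
    (hS : S ∈ nestedCuts G P) :
    (∃ i, S = halfSpace κ i) ∨
      ∃ i, ∃ a : C i, a ≠ 1 ∧ (S ⊆ {x | κ i x = a} ∨ Sᶜ ⊆ {x | κ i x = a}) := by
  obtain ⟨γ, k, rfl⟩ := h.exists_eq_smul_halfSpace hP hprime hS
  induction γ using reducedWord_induction with
  | one => exact Or.inl ⟨k, by simp⟩
  | mul j a w ha hw _ =>
    refine Or.inr ⟨j, a, ha, ?_⟩
    rw [← Set.smul_set_compl, ← h.of_smul_halfSpace_not, map_mul, mul_smul, mul_smul]
    exact (h.smul_halfSpace_subset w hw k).imp (fun hs => Set.smul_set_mono hs)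
      (fun hs => Set.smul_set_mono hs)

/-- The members of `N` which are maximal among those strictly contained in `S`. -/
def maximalBelow (N : Set (Set E)) (S : Set E) : Set (Set E) :=
  {K | K ∈ N ∧ K ⊂ S ∧ ∀ K' ∈ N, K ⊂ K' → ¬ K' ⊂ S}

theorem maximalBelow_smul {N : Set (Set E)} (hN : ∀ g : G, ∀ K ∈ N, g • K ∈ N) (g : G)
    (S : Set E) : maximalBelow N (g • S) = (fun K => g • K) '' maximalBelow N S := by
  have hss : ∀ (g : G) (A B : Set E), g • A ⊂ g • B ↔ A ⊂ B := by
    intro g A B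
    simp only [ssubset_iff_subset_not_subset, Set.smul_set_subset_smul_set_iff]
  have hsub : ∀ (g : G) (S : Set E), ∀ K ∈ maximalBelow N S, g • K ∈ maximalBelow N (g • S) := by
    rintro g S K ⟨h1, h2, h3⟩
    refine ⟨hN g K h1, (hss g _ _).2 h2, fun K' hK' h4 h5 => ?_⟩
    refine h3 (g⁻¹ • K') (hN _ _ hK') ?_ ?_
    · rwa [← hss g, smul_inv_smul]
    · rwa [← hss g, smul_inv_smul]
  apply subset_antisymm
  · intro K hK
    exact ⟨g⁻¹ • K, by simpa using hsub g⁻¹ _ K hK, smul_inv_smul g K⟩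
  · rintro _ ⟨K, hK, rfl⟩
    exact hsub g S K hK

theorem IsBranching.maximalBelow_halfSpace (h : IsBranching P φ κ) (hP : IsCutAlgebra G P)
    [Nonempty E] (hprime : ∀ i, (Nat.card (C i)).Prime) (hthree : ∀ i, 3 ≤ Nat.card (C i))
    (i : Bool) :
    maximalBelow (nestedCuts G P) (halfSpace κ i) = (fun a => {x | κ i x = a}) '' {1}ᶜ := by
  have : ∀ i, Finite (C i) := fun i => Nat.finite_of_card_ne_zero (hprime i).ne_zero
  have : ∀ i, Nontrivial (C i) := fun i => Finite.one_lt_card_iff_nontrivial.1 (hprime i).one_lt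
  have hthird : ∀ i (a : C i), ∃ b, b ≠ 1 ∧ b ≠ a := by
    intro i a
    by_contra! hc
    have h1 : (Set.univ : Set (C i)) ⊆ {1, a} := fun b _ => by
      by_cases hb : b = 1
      · exact Or.inl hb
      · exact Or.inr (hc b hb)
    have h2 := Set.ncard_le_ncard h1
    have h3 := Set.ncard_insert_le (1 : C i) {a}
    have := hthree i
    rw [Set.ncard_univ] at h2
    rw [Set.ncard_singleton] at h3
    omega
  have hcut : ∀ a : C i, {x | κ i x = a} ∈ nestedCuts G P := by
    intro a
    rw [← h.of_smul_halfSpace_not]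
    exact hP.smul_mem_nestedCuts _ (h.halfSpace_mem_nestedCuts hP hprime _)
  have hss : ∀ a : C i, a ≠ 1 → {x | κ i x = a} ⊂ halfSpace κ i := by
    intro a ha
    obtain ⟨b, hb, hba⟩ := hthird i a
    obtain ⟨y, rfl⟩ := h.surjective i b
    exact ⟨fun x hx hx1 => ha (hx.symm.trans hx1), fun hs => hba (hs hb)⟩
  have hbelow : ∀ K ∈ nestedCuts G P, K ⊂ halfSpace κ i →
      ∃ a, a ≠ 1 ∧ K ⊆ {x | κ i x = a} := by
    intro K hK hKi
    obtain ⟨x, hx⟩ := hK.2.1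
    rcases h.subset_branch_of_mem_nestedCuts hP hprime hK with ⟨k, rfl⟩ | ⟨k, a, ha, hKa⟩
    · rcases Bool.eq_or_eq_not k i with rfl | rfl
      · exact absurd hKi (ssubset_irrefl _)
      · have := hKi.1 hx
        rw [h.halfSpace_not] at hx
        exact absurd this hx
    · rcases Bool.eq_or_eq_not k i with rfl | rfl
      · refine ⟨a, ha, hKa.resolve_right fun hKa => ?_⟩
        obtain ⟨y, hy⟩ := h.surjective k 1
        have : y ∈ Kᶜ := fun hyK => hKi.1 hyK hy
        exact ha ((hKa this).symm.trans hy)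
      · exfalso
        rcases hKa with hKa | hKa
        · have h1 : κ i x = 1 := by
            rw [h.eq_one_iff, show κ (!i) x = a from hKa hx]
            exact ha
          exact hKi.1 hx h1
        · obtain ⟨b, hb, hba⟩ := hthird (!i) a
          obtain ⟨y, rfl⟩ := h.surjective _ b
          have : y ∈ Kᶜ := fun hyK => hKi.1 hyK ((h.eq_one_iff i y).2 hb)
          exact hba (hKa this)
  ext K
  constructor
  · rintro ⟨hK, hKi, hmax⟩
    obtain ⟨a, ha, hKa⟩ := hbelow K hK hKi
    refine ⟨a, ha, ?_⟩
    by_contra hne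
    exact hmax _ (hcut a) (hKa.ssubset_of_ne fun he => hne he.symm) (hss a ha)
  · rintro ⟨a, ha, rfl⟩
    refine ⟨hcut a, hss a ha, fun K' hK' h1 h2 => ?_⟩
    obtain ⟨b, hb, hK'b⟩ := hbelow K' hK' h2
    obtain ⟨x, rfl⟩ := h.surjective i a
    have : κ i x = b := hK'b (h1.1 rfl)
    subst this
    exact h1.2 hK'b

/-- The orders of the two factors are determined by the family of nested cuts. -/
theorem IsBranching.exists_card_eq_iff (h : IsBranching P φ κ) (hP : IsCutAlgebra G P)
    [Nonempty E] (hprime : ∀ i, (Nat.card (C i)).Prime) (hthree : ∀ i, 3 ≤ Nat.card (C i))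
    (n : ℕ) :
    (∃ i, n = Nat.card (C i)) ↔
      ∃ S ∈ nestedCuts G P, n = (maximalBelow (nestedCuts G P) S).ncard + 1 := by
  have : ∀ i, Finite (C i) := fun i => Nat.finite_of_card_ne_zero (hprime i).ne_zero
  have hcard : ∀ i,
      (maximalBelow (nestedCuts G P) (halfSpace κ i)).ncard + 1 = Nat.card (C i) := by
    intro i
    rw [h.maximalBelow_halfSpace hP hprime hthree, Set.ncard_image_of_injective]
    · have := Set.ncard_add_ncard_compl ({1} : Set (C i))
      rw [Set.ncard_singleton] at this
      omega
    · intro a b hab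
      obtain ⟨x, rfl⟩ := h.surjective i a
      have : x ∈ {y | κ i y = b} := by
        rw [← show {y | κ i y = κ i x} = {y | κ i y = b} from hab]
        rfl
      exact this
  constructor
  · rintro ⟨i, rfl⟩
    exact ⟨_, h.halfSpace_mem_nestedCuts hP hprime i, (hcard i).symm⟩
  · rintro ⟨S, hS, rfl⟩
    obtain ⟨γ, i, rfl⟩ := h.exists_eq_smul_halfSpace hP hprime hS
    refine ⟨i, ?_⟩
    rw [maximalBelow_smul fun g K => hP.smul_mem_nestedCuts g,
      Set.ncard_image_of_injective _ (MulAction.injective (φ γ)), hcard]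

end Counting

section Ends

variable {X : Type u} [MetricSpace X]

/-- The ultrafilters at infinity of a metric space. -/
def Ends (X : Type u) [MetricSpace X] : Type u :=
  {U : Ultrafilter X // (U : Filter X) ≤ cobounded X}

/-- The ultrafilters at infinity containing `Y`. -/
def endsOf (Y : Set X) : Set (Ends X) := {U | Y ∈ U.1}

noncomputable instance : MulAction (X ≃ᵢ X) (Ends X) where
  smul g U := ⟨U.1.map g, (map_mono U.2).trans g.isometry.antilipschitz.tendsto_cobounded⟩
  one_smul _ := Subtype.ext (Ultrafilter.map_id _)
  mul_smul g k U := Subtype.ext (Ultrafilter.map_map U.1 k g).symm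

theorem mem_endsOf {Y : Set X} {U : Ends X} : U ∈ endsOf Y ↔ ∀ᶠ x in (U.1 : Filter X), x ∈ Y :=
  Iff.rfl

theorem endsOf_compl (Y : Set X) : endsOf Yᶜ = (endsOf Y)ᶜ := by
  ext U
  exact Ultrafilter.compl_mem_iff_notMem

theorem endsOf_inter (Y Z : Set X) : endsOf (Y ∩ Z) = endsOf Y ∩ endsOf Z := by
  ext U
  exact inter_mem_iff

theorem smul_endsOf (g : X ≃ᵢ X) (Y : Set X) : g • endsOf Y = endsOf (g '' Y) := by
  ext U
  rw [Set.mem_smul_set_iff_inv_smul_mem]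
  change (g⁻¹ : X ≃ᵢ X) ⁻¹' Y ∈ U.1 ↔ g '' Y ∈ U.1
  rw [show (g⁻¹ : X ≃ᵢ X) ⁻¹' Y = g '' Y from congrFun g.preimage_symm Y]

theorem Ends.eventually_of_isBounded (U : Ends X) {B : Set X} (hB : IsBounded B) :
    ∀ᶠ x in (U.1 : Filter X), x ∉ B :=
  U.2 (isBounded_def.1 hB)

theorem endsOf_nonempty {Y : Set X} (hY : ¬ IsBounded Y) : (endsOf Y).Nonempty := by
  have : (cobounded X ⊓ 𝓟 Y).NeBot := by
    rw [inf_principal_neBot_iff]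
    intro V hV
    by_contra hc
    refine hY ((isBounded_compl_iff.2 hV).subset fun y hy hyV => hc ⟨y, hyV, hy⟩)
  have h := Ultrafilter.of_le (cobounded X ⊓ 𝓟 Y)
  exact ⟨⟨Ultrafilter.of (cobounded X ⊓ 𝓟 Y), h.trans inf_le_left⟩, le_principal_iff.1
    (h.trans inf_le_right)⟩

theorem Crosses.of_endsOf {Y Z : Set X} (h : Crosses (endsOf Y) (endsOf Z)) : Crosses Y Z := by
  have key : ∀ A : Set X, (endsOf A).Nonempty → A.Nonempty := fun A ⟨U, hU⟩ =>
    Filter.nonempty_of_mem (mem_endsOf.1 hU)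
  simp only [Crosses, ← endsOf_compl, ← endsOf_inter] at h
  exact ⟨key _ h.1, key _ h.2.1, key _ h.2.2.1, key _ h.2.2.2⟩

theorem endsOf_congr {Y Z B : Set X} (hB : IsBounded B) (h : ∀ x ∉ B, (x ∈ Y ↔ x ∈ Z)) :
    endsOf Y = endsOf Z := by
  ext U
  exact eventually_congr ((U.eventually_of_isBounded hB).mono h)

/-- The points within distance `r` of a point on the other side of `Y`. -/
def coarseBoundary (r : ℝ) (Y : Set X) : Set X := {x | ∃ y, dist x y ≤ r ∧ (x ∈ Y ↔ y ∉ Y)}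

theorem coarseBoundary_compl (r : ℝ) (Y : Set X) : coarseBoundary r Yᶜ = coarseBoundary r Y := by
  ext x
  simp only [coarseBoundary, Set.mem_compl_iff, Set.mem_ofPred_eq, not_not]
  grind

theorem coarseBoundary_inter_subset (r : ℝ) (Y Z : Set X) :
    coarseBoundary r (Y ∩ Z) ⊆ coarseBoundary r Y ∪ coarseBoundary r Z := by
  rintro x ⟨y, hxy, h⟩
  by_cases hY : x ∈ Y ↔ y ∉ Y
  · exact Or.inl ⟨y, hxy, hY⟩
  · refine Or.inr ⟨y, hxy, ?_⟩
    simp only [Set.mem_inter_iff] at h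
    tauto

theorem coarseBoundary_image (r : ℝ) (g : X ≃ᵢ X) (Y : Set X) :
    coarseBoundary r (g '' Y) = g '' coarseBoundary r Y := by
  ext x
  obtain ⟨x, rfl⟩ := g.surjective x
  rw [g.injective.mem_set_image]
  constructor
  · rintro ⟨y, hxy, h⟩
    obtain ⟨y, rfl⟩ := g.surjective y
    rw [g.injective.mem_set_image, g.injective.mem_set_image] at h
    exact ⟨y, by rwa [← g.dist_eq], h⟩
  · rintro ⟨y, hxy, h⟩
    refine ⟨g y, by rwa [g.dist_eq], ?_⟩
    rwa [g.injective.mem_set_image, g.injective.mem_set_image]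

theorem mem_iff_mem_of_notMem_coarseBoundary {r : ℝ} {Y : Set X} {x y : X}
    (hx : x ∉ coarseBoundary r Y) (hxy : dist x y ≤ r) : x ∈ Y ↔ y ∈ Y := by
  by_contra h
  exact hx ⟨y, hxy, by tauto⟩

/-- The cuts of the space of ends given by sets with bounded coarse boundaries. -/
def coarseCuts (X : Type u) [MetricSpace X] : Set (Set (Ends X)) :=
  {S | ∃ Y : Set X, (∀ r, IsBounded (coarseBoundary r Y)) ∧ S = endsOf Y}

/-- `X` is connected at scale `r`. -/
def IsCoarselyConnected (X : Type u) [MetricSpace X] (r : ℝ) : Prop :=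
  ∀ Y : Set X, coarseBoundary r Y = ∅ → Y = ∅ ∨ Y = Set.univ

theorem IsCoarselyConnected.not_crosses {r : ℝ} (h : IsCoarselyConnected X r) {A B : Set X}
    (hA : coarseBoundary r A ⊆ B ∨ coarseBoundary r A ⊆ Bᶜ)
    (hB : coarseBoundary r B ⊆ A ∨ coarseBoundary r B ⊆ Aᶜ) : ¬ Crosses A B := by
  have key : ∀ A B : Set X, coarseBoundary r A ⊆ Bᶜ → coarseBoundary r B ⊆ Aᶜ →
      ¬ Crosses A B := by
    rintro A B hA hB ⟨⟨x, hx⟩, ⟨y, hy⟩, -, -⟩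
    have hempty : coarseBoundary r (A ∩ B) = ∅ := by
      have key' : ∀ z w, dist z w ≤ r → z ∈ A ∩ B → w ∉ A ∩ B → False := by
        intro z w hzw hz hw
        by_cases hwA : w ∈ A
        · exact hB ⟨w, hzw, iff_of_true hz.2 fun hwB => hw ⟨hwA, hwB⟩⟩ hz.1
        · exact hA ⟨w, hzw, iff_of_true hz.1 hwA⟩ hz.2
      refine Set.eq_empty_iff_forall_notMem.2 ?_
      rintro z ⟨w, hzw, hc⟩
      by_cases hz : z ∈ A ∩ B
      · exact key' z w hzw hz (hc.1 hz)
      · exact key' w z (by rwa [dist_comm]) (by tauto) hz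
    rcases h (A ∩ B) hempty with he | he
    · exact (he ▸ hx : x ∈ (∅ : Set X))
    · exact hy.2 (he.symm ▸ Set.mem_univ y : y ∈ A ∩ B).2
  rcases hA with hA | hA <;> rcases hB with hB | hB
  · rw [← crosses_compl_left, ← crosses_compl_right]
    exact key _ _ (by simpa [coarseBoundary_compl] using hA)
      (by simpa [coarseBoundary_compl] using hB)
  · rw [← crosses_compl_right]
    exact key _ _ (by simpa [coarseBoundary_compl] using hA)
      (by simpa [coarseBoundary_compl] using hB)
  · rw [← crosses_compl_left]
    exact key _ _ (by simpa [coarseBoundary_compl] using hA)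
      (by simpa [coarseBoundary_compl] using hB)
  · exact key _ _ hA hB

theorem subset_or_subset_compl {S Y : Set X} {ρ : ℝ} (hS : ∀ x ∈ S, ∀ y ∈ S, dist x y ≤ ρ)
    (h : ∀ x ∈ S, x ∉ coarseBoundary ρ Y) : S ⊆ Y ∨ S ⊆ Yᶜ := by
  by_contra! hc
  obtain ⟨x, hx, hxY⟩ := Set.not_subset.1 hc.1
  obtain ⟨y, hy, hyY⟩ := Set.not_subset.1 hc.2
  exact h x hx ⟨y, hS x hx y hy, by simp_all⟩

theorem IsCoarselyConnected.exists_isBounded_of_crosses {r : ℝ} (h : IsCoarselyConnected X r)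
    [Nonempty X] {A B : Set X} (hA : ∀ r, IsBounded (coarseBoundary r A))
    (hB : ∀ r, IsBounded (coarseBoundary r B)) :
    ∃ Q : Set X, Q.Nonempty ∧ IsBounded Q ∧
      ∀ g : X ≃ᵢ X, Crosses (g '' A) B → coarseBoundary r (g '' A) ⊆ Q := by
  obtain ⟨ρ, hρ⟩ := Metric.isBounded_iff.1 (hA r)
  obtain ⟨σ, hσ⟩ := Metric.isBounded_iff.1 (hB r)
  obtain ⟨τ, hτ⟩ := Metric.isBounded_iff.1 ((hA σ).union (hA r))
  obtain ⟨x₀⟩ := ‹Nonempty X›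
  obtain ⟨L, hL⟩ := (((hB ρ).union (hB r)).subset_closedBall x₀)
  refine ⟨Metric.closedBall x₀ (|ρ| + |τ| + |L|), ⟨x₀, ?_⟩, Metric.isBounded_closedBall,
    fun g hc => ?_⟩
  · simp only [Metric.mem_closedBall, dist_self]
    positivity
  have h1 : (∃ s ∈ coarseBoundary r A, g s ∈ coarseBoundary ρ B) ∨
      ∃ s ∈ coarseBoundary σ A, g s ∈ coarseBoundary r B := by
    by_contra! hno
    refine h.not_crosses ?_ ?_ hc
    · rw [coarseBoundary_image]
      refine subset_or_subset_compl (ρ := ρ) ?_ ?_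
      · rintro _ ⟨x, hx, rfl⟩ _ ⟨y, hy, rfl⟩
        rw [g.dist_eq]
        exact hρ hx hy
      · rintro _ ⟨x, hx, rfl⟩
        exact hno.1 x hx
    · refine subset_or_subset_compl (ρ := σ) (fun x hx y hy => hσ hx hy) ?_
      rw [coarseBoundary_image]
      rintro _ hx ⟨x, hxA, rfl⟩
      exact hno.2 x hxA hx
  rw [coarseBoundary_image]
  rintro _ ⟨x, hx, rfl⟩
  rw [Metric.mem_closedBall]
  have hL' : ∀ y, y ∈ coarseBoundary ρ B ∪ coarseBoundary r B → dist y x₀ ≤ L := fun y hy => hL hy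
  rcases h1 with ⟨s, hs, hgs⟩ | ⟨s, hs, hgs⟩
  · calc dist (g x) x₀ ≤ dist (g x) (g s) + dist (g s) x₀ := dist_triangle _ _ _
      _ ≤ ρ + L := by
        rw [g.dist_eq]
        exact add_le_add (hρ hx hs) (hL' _ (Or.inl hgs))
      _ ≤ |ρ| + |τ| + |L| := by
        linarith [le_abs_self ρ, abs_nonneg τ, le_abs_self L]
  · calc dist (g x) x₀ ≤ dist (g x) (g s) + dist (g s) x₀ := dist_triangle _ _ _
      _ ≤ τ + L := by
        rw [g.dist_eq]
        exact add_le_add (hτ (Or.inr hx) (Or.inl hs)) (hL' _ (Or.inr hgs))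
      _ ≤ |ρ| + |τ| + |L| := by
        linarith [le_abs_self τ, abs_nonneg ρ, le_abs_self L]

theorem IsCoarselyConnected.finite_endsOf [ProperSpace X] {r : ℝ} (h : IsCoarselyConnected X r)
    (hr : 0 < r) {Q : Set X} (hQ : IsBounded Q) (hQne : Q.Nonempty) :
    {S | ∃ Y : Set X, coarseBoundary r Y ⊆ Q ∧ S = endsOf Y}.Finite := by
  set R := Metric.cthickening r Q \ Q
  have hR : TotallyBounded R :=
    ((hQ.cthickening (δ := r)).isCompact_closure.totallyBounded.subset subset_closure).subset
      Set.sdiff_subset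
  obtain ⟨t, ht, htR⟩ := Metric.totallyBounded_iff.1 hR (r / 2) (by positivity)
  have hchoose : ∀ S : Set (Ends X), ∃ Y : Set X,
      (∃ Y : Set X, coarseBoundary r Y ⊆ Q ∧ S = endsOf Y) →
        coarseBoundary r Y ⊆ Q ∧ S = endsOf Y := by
    intro S
    by_cases hS : ∃ Y : Set X, coarseBoundary r Y ⊆ Q ∧ S = endsOf Y
    · exact hS.imp fun Y hY _ => hY
    · exact ⟨∅, fun h => absurd h hS⟩
  choose Y hY using hchoose
  set code : Set X → Set X := fun Y => {c ∈ t | ∃ y ∈ Y ∩ R, dist y c < r / 2}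
  have hR' : ∀ Z Z' : Set X, coarseBoundary r Z' ⊆ Q → code Z = code Z' →
      ∀ x ∈ R, x ∈ Z → x ∈ Z' := by
    intro Z Z' hZ' he x hxR hx
    obtain ⟨c, hct, hxc⟩ := Set.mem_iUnion₂.1 (htR hxR)
    have hc : c ∈ code Z := ⟨hct, x, ⟨hx, hxR⟩, hxc⟩
    rw [he] at hc
    obtain ⟨-, y, ⟨hy, -⟩, hyc⟩ := hc
    refine (mem_iff_mem_of_notMem_coarseBoundary (fun hxb => hxR.2 (hZ' hxb)) ?_).2 hy
    have h1 := dist_triangle_right x y c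
    have h2 : dist x c < r / 2 := hxc
    linarith
  refine Set.Finite.of_injOn (f := fun S => code (Y S)) (t := 𝒫 t) ?_ ?_ ht.powerset
  · exact fun S _ c hc => hc.1
  · intro S hS S' hS' he
    obtain ⟨h1, h2⟩ := hY S hS
    obtain ⟨h3, h4⟩ := hY S' hS'
    have hagree : ∀ x ∈ R, (x ∈ Y S ↔ x ∈ Y S') := fun x hx =>
      ⟨hR' _ _ h3 he x hx, hR' _ _ h1 he.symm x hx⟩
    set Z := {x | x ∉ Q ∧ ¬ (x ∈ Y S ↔ x ∈ Y S')}
    have hZb : coarseBoundary r Z = ∅ := by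
      have key : ∀ x y, dist x y ≤ r → x ∈ Z → y ∈ Z := by
        rintro x y hxy ⟨hxQ, hx⟩
        have hyQ : y ∉ Q := fun hy => hx
          (hagree x ⟨Metric.mem_cthickening_of_dist_le x y r Q hy hxy, hxQ⟩)
        refine ⟨hyQ, ?_⟩
        rwa [← mem_iff_mem_of_notMem_coarseBoundary (fun hxb => hxQ (h1 hxb)) hxy,
          ← mem_iff_mem_of_notMem_coarseBoundary (fun hxb => hxQ (h3 hxb)) hxy]
      refine Set.eq_empty_iff_forall_notMem.2 ?_
      rintro x ⟨y, hxy, hc⟩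
      have hk1 := key x y hxy
      have hk2 := key y x (by rwa [dist_comm])
      tauto
    rcases h Z hZb with he' | he'
    · rw [h2, h4]
      refine endsOf_congr hQ fun x hx => ?_
      by_contra hc
      exact (he' ▸ (⟨hx, hc⟩ : x ∈ Z) : x ∈ (∅ : Set X))
    · obtain ⟨x, hx⟩ := hQne
      exact absurd hx (he'.symm ▸ Set.mem_univ x : x ∈ Z).1

theorem IsCoarselyConnected.isCutAlgebra [ProperSpace X] [Nonempty X] {r : ℝ}
    (h : IsCoarselyConnected X r) (hr : 0 < r) : IsCutAlgebra (X ≃ᵢ X) (coarseCuts X) := by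
  refine ⟨?_, ?_, ?_, ?_⟩
  · rintro _ ⟨Y, hY, rfl⟩
    exact ⟨Yᶜ, fun r => by rw [coarseBoundary_compl]; exact hY r, (endsOf_compl Y).symm⟩
  · rintro _ ⟨Y, hY, rfl⟩ _ ⟨Z, hZ, rfl⟩
    exact ⟨Y ∩ Z, fun r => ((hY r).union (hZ r)).subset (coarseBoundary_inter_subset r Y Z),
      (endsOf_inter Y Z).symm⟩
  · rintro g _ ⟨Y, hY, rfl⟩
    refine ⟨g '' Y, fun r => ?_, smul_endsOf g Y⟩
    rw [coarseBoundary_image]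
    exact g.isometry.lipschitz.isBounded_image (hY r)
  · rintro _ ⟨A, hA, rfl⟩ _ ⟨B, hB, rfl⟩
    obtain ⟨Q, hQne, hQ, hcross⟩ := h.exists_isBounded_of_crosses hA hB
    refine (h.finite_endsOf hr hQ hQne).subset ?_
    rintro _ ⟨⟨g, rfl⟩, hc⟩
    change Crosses (g • endsOf A) _ at hc
    rw [smul_endsOf] at hc
    exact ⟨g '' A, hcross g hc.of_endsOf, smul_endsOf g A⟩

end Ends

section Actions

open Monoid

variable {X : Type u} [MetricSpace X]

/-- An isometric action is proper and cocompact. -/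
structure IsProperCocompact {Γ : Type*} [Group Γ] (ψ : Γ →* (X ≃ᵢ X)) : Prop where
  proper : ∀ B : Set X, IsBounded B → {γ | (ψ γ '' B ∩ B).Nonempty}.Finite
  cocompact : ∃ K : Set X, IsCompact K ∧ ∀ x : X, ∃ γ, x ∈ ψ γ '' K

theorem IsProperCocompact.comp {Γ Δ : Type*} [Group Γ] [Group Δ] {ψ : Γ →* (X ≃ᵢ X)}
    (h : IsProperCocompact ψ) (e : Δ ≃* Γ) : IsProperCocompact (ψ.comp e.toMonoidHom) := by
  refine ⟨fun B hB => Set.Finite.preimage (f := e) e.injective.injOn (h.proper B hB), ?_⟩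
  obtain ⟨K, hK, hcov⟩ := h.cocompact
  refine ⟨K, hK, fun x => ?_⟩
  obtain ⟨γ, hγ⟩ := hcov x
  exact ⟨e.symm γ, by simpa using hγ⟩

theorem IsProperCocompact.nonempty_ends {Γ : Type*} [Group Γ] [Infinite Γ] {ψ : Γ →* (X ≃ᵢ X)}
    (h : IsProperCocompact ψ) [Nonempty X] : Nonempty (Ends X) := by
  have : ¬ IsBounded (Set.univ : Set X) := by
    intro hb
    refine Set.infinite_univ (α := Γ) ((h.proper _ hb).subset fun γ _ => ?_)
    obtain ⟨x⟩ := ‹Nonempty X›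
    exact ⟨ψ γ x, ⟨x, trivial, rfl⟩, trivial⟩
  exact (endsOf_nonempty this).nonempty

theorem IsProperCocompact.finite_orbit_mem {Γ : Type*} [Group Γ] {ψ : Γ →* (X ≃ᵢ X)}
    (h : IsProperCocompact ψ) (x₀ : X) {B : Set X} (hB : IsBounded B) :
    {γ | ψ γ x₀ ∈ B}.Finite :=
  (h.proper (insert x₀ B) (hB.insert x₀)).subset fun γ hγ =>
    ⟨ψ γ x₀, ⟨x₀, Set.mem_insert _ _, rfl⟩, Set.mem_insert_of_mem _ hγ⟩

theorem isBounded_preimage_of_finite {Γ : Type*} [Group Γ] {ψ : Γ →* (X ≃ᵢ X)} {K : Set X}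
    (hK : IsCompact K) {f : X → Γ} (hf : ∀ x, x ∈ ψ (f x) '' K) {S : Set Γ} (hS : S.Finite) :
    IsBounded (f ⁻¹' S) := by
  refine ((isBounded_biUnion hS).2 fun γ _ =>
    (hK.image (ψ γ).continuous).isBounded).subset fun x hx => ?_
  exact Set.mem_biUnion (show f x ∈ S from hx) (hf x)

/-- A coarse inverse `f` of the orbit map is equivariant up to finitely many right
translations. -/
theorem IsProperCocompact.exists_finite_inv_mul_mem {Γ : Type*} [Group Γ] {ψ : Γ →* (X ≃ᵢ X)}
    (h : IsProperCocompact ψ) {K : Set X} (hK : IsCompact K) {f : X → Γ}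
    (hf : ∀ x, x ∈ ψ (f x) '' K) (r : ℝ) :
    ∃ T : Set Γ, T.Finite ∧ ∀ γ x y, dist (ψ γ x) y ≤ r → (γ * f x)⁻¹ * f y ∈ T := by
  refine ⟨_, h.proper _ (hK.isBounded.cthickening (δ := r)), fun γ x y hxy => ?_⟩
  obtain ⟨k, hk, hkx⟩ := hf x
  obtain ⟨l, hl, hly⟩ := hf y
  refine ⟨ψ ((γ * f x)⁻¹ * f y) l, ⟨l, Metric.self_subset_cthickening K hl, rfl⟩, ?_⟩
  refine Metric.mem_cthickening_of_dist_le _ k r K hk ?_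
  rw [← (ψ (γ * f x)).dist_eq, ← IsometryEquiv.mul_apply, ← map_mul, mul_inv_cancel_left, hly,
    map_mul, IsometryEquiv.mul_apply, hkx, dist_comm]
  exact hxy

variable {C : Bool → Type} [∀ i, Group (C i)] {ψ : CoprodI C →* (X ≃ᵢ X)}

theorem IsProperCocompact.exists_isCoarselyConnected [∀ i, Finite (C i)] [Nonempty X]
    (h : IsProperCocompact ψ) : ∃ r, 0 < r ∧ IsCoarselyConnected X r := by
  obtain ⟨K, hK, hcov⟩ := h.cocompact
  obtain ⟨x⟩ := ‹Nonempty X›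
  obtain ⟨-, k₀, hk₀, -⟩ := hcov x
  have hfin : (Set.range fun p : Σ i, C i => ψ (CoprodI.of p.2) k₀).Finite := Set.finite_range _
  obtain ⟨r, hr⟩ := (hK.isBounded.union hfin.isBounded).subset_closedBall k₀
  refine ⟨max r 1, lt_max_of_lt_right one_pos, fun Y hY => ?_⟩
  have hiff : ∀ x y, dist x y ≤ r → (x ∈ Y ↔ y ∈ Y) := fun x y hxy =>
    mem_iff_mem_of_notMem_coarseBoundary (hY ▸ Set.notMem_empty x) (hxy.trans (le_max_left _ _))
  have hmul : ∀ δ γ : CoprodI C, ψ γ k₀ ∈ Y ↔ ψ (γ * δ) k₀ ∈ Y := by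
    intro δ
    induction δ using CoprodI.induction_on with
    | one => simp
    | of i s =>
      intro γ
      apply hiff
      rw [map_mul, IsometryEquiv.mul_apply, (ψ γ).dist_eq, dist_comm]
      exact hr (Or.inr ⟨⟨i, s⟩, rfl⟩)
    | mul a b ha hb =>
      intro γ
      rw [ha γ, hb (γ * a), mul_assoc]
  have hall : ∀ x, x ∈ Y ↔ k₀ ∈ Y := by
    intro x
    obtain ⟨γ, k, hk, rfl⟩ := hcov x
    have h1 : ψ γ k ∈ Y ↔ ψ γ k₀ ∈ Y := hiff _ _ (by
      rw [(ψ γ).dist_eq]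
      exact hr (Or.inl hk))
    have h2 := hmul γ 1
    rw [map_one, one_mul] at h2
    exact h1.trans h2.symm
  by_cases hk : k₀ ∈ Y
  · exact Or.inr (Set.eq_univ_of_forall fun x => (hall x).2 hk)
  · exact Or.inl (Set.eq_empty_of_forall_notMem fun x hx => hk ((hall x).1 hx))

theorem IsProperCocompact.isBounded_firstLetter_ne [∀ i, Finite (C i)]
    (h : IsProperCocompact ψ) {K : Set X} (hK : IsCompact K) {f : X → CoprodI C}
    (hf : ∀ x, x ∈ ψ (f x) '' K) (r : ℝ) (γ : CoprodI C) (i : Bool) :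
    IsBounded {x | ∃ y, dist (ψ γ x) y ≤ r ∧
      firstLetter i (f y) ≠ firstLetter i (γ * f x)} := by
  obtain ⟨T, hT, hTmem⟩ := h.exists_finite_inv_mul_mem hK hf r
  have hfin : (⋃ t ∈ T, (γ * ·) ⁻¹' {δ | firstLetter i (δ * t) ≠ firstLetter i δ}).Finite :=
    hT.biUnion fun t _ =>
      (finite_firstLetter_mul_ne t i).preimage (mul_right_injective γ).injOn
  refine (isBounded_preimage_of_finite hK hf hfin).subset ?_
  rintro x ⟨y, hxy, hne⟩
  refine Set.mem_biUnion (hTmem γ x y hxy) ?_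
  simpa only [Set.mem_preimage, Set.mem_ofPred_eq, mul_inv_cancel_left] using hne

/-- If the orbit crosses the boundary of `Y` only at words of length at most `n` in the branch
`i`, then the ends of `Y` are constant at depth `n`. -/
theorem constantAtDepth_endsOf {K : Set X} (hK : IsCompact K) {f : X → CoprodI C}
    (hf : ∀ x, x ∈ ψ (f x) '' K) {κ : ∀ i, Ends X → C i}
    (hκ : ∀ i U, ∀ᶠ x in (U.1 : Filter X), firstLetter i (f x) = κ i U) (x₀ : X) (n : ℕ)
    {i : Bool} {Y : Set X} (hY : ∀ r, IsBounded (coarseBoundary r Y))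
    (hn : ∀ γ, (∃ (k : Bool) (s : C k), ¬ (ψ γ x₀ ∈ Y ↔ ψ (γ * CoprodI.of s) x₀ ∈ Y)) →
      firstLetter i γ ≠ 1 → syllableLength γ ≤ n) :
    ConstantAtDepth ψ κ n i (endsOf Y) := by
  induction n generalizing i Y with
  | zero =>
    have hW : ∀ γ, firstLetter i γ ≠ 1 → ∀ k (s : C k),
        γ ∈ {γ | ψ γ x₀ ∈ Y} ↔ γ * CoprodI.of s ∈ {γ | ψ γ x₀ ∈ Y} := by
      intro γ hγ k s
      by_contra hc
      have h0 := hn γ ⟨k, s, hc⟩ hγ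
      cases γ using reducedWord_induction with
      | one => exact hγ (firstLetter_one i)
      | mul j a w ha hw =>
        rw [syllableLength_of_mul ha hw] at h0
        omega
    obtain ⟨ρ, hρ⟩ := hK.isBounded.subset_closedBall x₀
    have hpt : ∀ U : Ends X, κ i U ≠ 1 →
        ∃ w, firstLetter i w ≠ 1 ∧ (U ∈ endsOf Y ↔ w ∈ {γ | ψ γ x₀ ∈ Y}) := by
      intro U hU
      have hev : ∀ᶠ x in (U.1 : Filter X), (x ∈ Y ↔ ψ (f x) x₀ ∈ Y) := by
        refine (U.eventually_of_isBounded (hY ρ)).mono fun x hx => ?_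
        apply mem_iff_mem_of_notMem_coarseBoundary hx
        obtain ⟨k, hk, hkx⟩ := hf x
        nth_rewrite 1 [← hkx]
        rw [(ψ (f x)).dist_eq]
        exact hρ hk
      by_cases hUY : U ∈ endsOf Y
      · obtain ⟨x, ⟨hx1, hx2⟩, hx3⟩ := ((hev.and (hκ i U)).and (mem_endsOf.1 hUY)).exists
        exact ⟨f x, hx2.trans_ne hU, iff_of_true hUY (hx1.1 hx3)⟩
      · have hUY' : U ∈ endsOf Yᶜ := by rwa [endsOf_compl]
        obtain ⟨x, ⟨hx1, hx2⟩, hx3⟩ := ((hev.and (hκ i U)).and (mem_endsOf.1 hUY')).exists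
        exact ⟨f x, hx2.trans_ne hU, iff_of_false hUY fun h => hx3 (hx1.2 h)⟩
    intro U V hU hV
    obtain ⟨u, hu, hu'⟩ := hpt U hU
    obtain ⟨v, hv, hv'⟩ := hpt V hV
    rw [hu', hv']
    exact mem_iff_mem_of_firstLetter_ne_one hW hu hv
  | succ n ih =>
    intro a ha
    rw [← map_inv, smul_endsOf]
    refine ih (fun r => ?_) ?_
    · rw [coarseBoundary_image]
      exact (ψ _).isometry.lipschitz.isBounded_image (hY r)
    · have hmem : ∀ γ, ψ γ x₀ ∈ ψ (CoprodI.of a)⁻¹ '' Y ↔ ψ (CoprodI.of a * γ) x₀ ∈ Y := by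
        intro γ
        rw [← (ψ (CoprodI.of a)⁻¹).injective.mem_set_image (s := Y), ← IsometryEquiv.mul_apply,
          ← map_mul, inv_mul_cancel_left]
      rintro γ ⟨k, s, hc⟩ hγ
      rw [hmem, hmem, ← mul_assoc] at hc
      have hγ1 : firstLetter i γ = 1 := firstLetter_of_not hγ
      have := hn (CoprodI.of a * γ) ⟨k, s, hc⟩ (by rwa [firstLetter_of_mul, hγ1, mul_one])
      rw [syllableLength_of_mul ha hγ1] at this
      omega

theorem IsProperCocompact.exists_isBranching [∀ i, Finite (C i)] [Nonempty X]
    (h : IsProperCocompact ψ) :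
    ∃ κ : ∀ i, Ends X → C i, IsBranching (coarseCuts X) ψ κ := by
  obtain ⟨K, hK, hcov⟩ := h.cocompact
  choose f hf using hcov
  have hlim : ∀ i (U : Ends X), ∃ a, ∀ᶠ x in (U.1 : Filter X), firstLetter i (f x) = a := by
    intro i U
    obtain ⟨a, ha⟩ := (U.1.map fun x => firstLetter i (f x)).eq_pure_of_finite
    refine ⟨a, ?_⟩
    have : {a} ∈ U.1.map fun x => firstLetter i (f x) := by
      rw [ha]
      exact Set.mem_singleton a
    exact this
  choose κ hκ using hlim
  have huniq : ∀ {i} {U : Ends X} {a}, (∀ᶠ x in (U.1 : Filter X), firstLetter i (f x) = a) →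
      κ i U = a := by
    intro i U a ha
    obtain ⟨x, hx, hx'⟩ := ((hκ i U).and ha).exists
    exact hx.symm.trans hx'
  refine ⟨κ, ?_, ?_, ?_, ?_⟩
  · intro i a U
    refine huniq ?_
    change ∀ᶠ x in (U.1 : Filter X), firstLetter i (f (ψ (CoprodI.of a) x)) = _
    filter_upwards [hκ i U, U.eventually_of_isBounded
      (h.isBounded_firstLetter_ne hK hf 0 (CoprodI.of a) i)] with x hx hx'
    rw [← hx, ← firstLetter_of_mul]
    by_contra hc
    exact hx' ⟨_, (dist_self _).le, hc⟩
  · intro i U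
    obtain ⟨x, ⟨hx, hx'⟩, hx1⟩ := (((hκ i U).and (hκ (!i) U)).and (U.eventually_of_isBounded
      (isBounded_preimage_of_finite hK hf (Set.finite_singleton 1)))).exists
    rw [← hx, ← hx']
    refine ⟨fun hi hi' => ?_, firstLetter_of_not⟩
    obtain ⟨j, hj⟩ := exists_firstLetter_ne_one hx1
    rcases Bool.eq_or_eq_not j i with rfl | rfl
    · exact hj hi
    · exact hj hi'
  · intro i
    refine ⟨{x | firstLetter i (f x) ≠ 1}, fun r => ?_, ?_⟩
    · refine (h.isBounded_firstLetter_ne hK hf r 1 i).subset ?_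
      rintro x ⟨y, hxy, hc⟩
      refine ⟨y, by simpa using hxy, fun he => ?_⟩
      rw [one_mul] at he
      simp [he] at hc
    · ext U
      rw [mem_endsOf]
      refine ⟨fun hU => (hκ i U).mono fun x hx => hx.trans_ne hU, fun hU => ?_⟩
      obtain ⟨x, hx, hx'⟩ := ((hκ i U).and hU).exists
      exact hx.symm.trans_ne hx'
  · rintro _ ⟨Y, hY, rfl⟩
    obtain ⟨x₀⟩ := ‹Nonempty X›
    have hgen : (Set.range fun p : Σ i, C i => ψ (CoprodI.of p.2) x₀).Finite := Set.finite_range _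
    obtain ⟨r, hr⟩ := hgen.isBounded.subset_closedBall x₀
    obtain ⟨n, hn⟩ := ((h.finite_orbit_mem x₀ (hY r)).image syllableLength).bddAbove
    refine ⟨n, fun i => constantAtDepth_endsOf hK hf hκ x₀ n hY ?_⟩
    rintro γ ⟨k, s, hc⟩ -
    refine hn ⟨γ, ⟨ψ (γ * CoprodI.of s) x₀, ?_, by tauto⟩, rfl⟩
    rw [map_mul, IsometryEquiv.mul_apply, (ψ γ).dist_eq, dist_comm]
    exact hr ⟨⟨k, s⟩, rfl⟩

/-- The orders of the factors of a free product of two groups of prime orders at least three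
acting properly cocompactly on `X` depend only on `X`. -/
theorem IsProperCocompact.exists_card_eq_iff [ProperSpace X] [Nonempty X]
    (h : IsProperCocompact ψ) (hprime : ∀ i, (Nat.card (C i)).Prime)
    (hthree : ∀ i, 3 ≤ Nat.card (C i)) (n : ℕ) :
    (∃ i, n = Nat.card (C i)) ↔ ∃ S ∈ nestedCuts (X ≃ᵢ X) (coarseCuts X),
      n = (maximalBelow (nestedCuts (X ≃ᵢ X) (coarseCuts X)) S).ncard + 1 := by
  have : ∀ i, Finite (C i) := fun i => Nat.finite_of_card_ne_zero (hprime i).ne_zero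
  have : ∀ i, Nontrivial (C i) := fun i => Finite.one_lt_card_iff_nontrivial.1 (hprime i).one_lt
  have := infinite_coprodI (C := C)
  have := h.nonempty_ends
  obtain ⟨r, hr, hconn⟩ := h.exists_isCoarselyConnected
  obtain ⟨κ, hκ⟩ := h.exists_isBranching
  exact hκ.exists_card_eq_iff (hconn.isCutAlgebra hr) hprime hthree n

/-- The binary coproduct of two cyclic groups as an indexed coproduct. -/
def coprodIMulEquivCoprod (p q : ℕ) :
    CoprodI (fun i : Bool => Multiplicative (ZMod (cond i p q))) ≃*
      Coprod (Multiplicative (ZMod p)) (Multiplicative (ZMod q)) :=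
  MonoidHom.toMulEquiv
    (CoprodI.lift fun i => match i with
      | true => Coprod.inl
      | false => Coprod.inr)
    (Coprod.lift
      (CoprodI.of (M := fun i : Bool => Multiplicative (ZMod (cond i p q))) (i := true))
      (CoprodI.of (M := fun i : Bool => Multiplicative (ZMod (cond i p q))) (i := false)))
    (by
      refine CoprodI.ext_hom _ _ fun i => MonoidHom.ext fun x => ?_
      cases i <;> simp [CoprodI.lift_of])
    (by
      refine Coprod.hom_ext ?_ ?_ <;> refine MonoidHom.ext fun x => ?_ <;>
        simp [CoprodI.lift_of])

theorem IsProperCocompact.eq_or_eq_iff [ProperSpace X] [Nonempty X] {p q : ℕ} (hp : p.Prime)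
    (hq : q.Prime) (hp3 : 3 ≤ p) (hq3 : 3 ≤ q)
    {ψ : Coprod (Multiplicative (ZMod p)) (Multiplicative (ZMod q)) →* (X ≃ᵢ X)}
    (h : IsProperCocompact ψ) (n : ℕ) :
    (n = p ∨ n = q) ↔ ∃ S ∈ nestedCuts (X ≃ᵢ X) (coarseCuts X),
      n = (maximalBelow (nestedCuts (X ≃ᵢ X) (coarseCuts X)) S).ncard + 1 := by
  have hcard : ∀ i, Nat.card (Multiplicative (ZMod (cond i p q))) = cond i p q := fun i =>
    Nat.card_zmod _
  rw [← (h.comp (coprodIMulEquivCoprod p q)).exists_card_eq_iff]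
  · simp only [hcard, Bool.exists_bool, cond_false, cond_true]
    tauto
  · intro i
    rw [hcard]
    cases i
    exacts [hq, hp]
  · intro i
    rw [hcard]
    cases i
    exacts [hq3, hp3]

end Actions

/-- **Corollary `pqpq`, second assertion.** If `{p₁,q₁} ≠ {p₂,q₂}` are distinct unordered
pairs of primes `≥ 3`, then the free products `C_{p₁} ∗ C_{q₁}` and `C_{p₂} ∗ C_{q₂}` do not
both act properly cocompactly by isometries on one and the same nonempty proper metric
space. -/
theorem free_products_no_common_proper_cocompact_action
    (p₁ q₁ p₂ q₂ : ℕ) (hp₁ : p₁.Prime) (hq₁ : q₁.Prime) (hp₂ : p₂.Prime) (hq₂ : q₂.Prime)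
    (hp₁3 : 3 ≤ p₁) (hq₁3 : 3 ≤ q₁) (hp₂3 : 3 ≤ p₂) (hq₂3 : 3 ≤ q₂)
    (hpairs : ({p₁, q₁} : Finset ℕ) ≠ ({p₂, q₂} : Finset ℕ))
    (X : Type u) [MetricSpace X] [ProperSpace X] [Nonempty X]
    (act₁ : Monoid.Coprod (Multiplicative (ZMod p₁)) (Multiplicative (ZMod q₁)) →* (X ≃ᵢ X))
    (act₂ : Monoid.Coprod (Multiplicative (ZMod p₂)) (Multiplicative (ZMod q₂)) →* (X ≃ᵢ X))
    (hproper₁ : ∀ B : Set X, Bornology.IsBounded B →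
      {γ | ((act₁ γ) '' B ∩ B).Nonempty}.Finite)
    (hcocompact₁ : ∃ K : Set X, IsCompact K ∧ ∀ x : X, ∃ γ, x ∈ (act₁ γ) '' K)
    (hproper₂ : ∀ B : Set X, Bornology.IsBounded B →
      {γ | ((act₂ γ) '' B ∩ B).Nonempty}.Finite)
    (hcocompact₂ : ∃ K : Set X, IsCompact K ∧ ∀ x : X, ∃ γ, x ∈ (act₂ γ) '' K) :
    False := by
  have h₁ : IsProperCocompact act₁ := ⟨hproper₁, hcocompact₁⟩
  have h₂ : IsProperCocompact act₂ := ⟨hproper₂, hcocompact₂⟩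
  refine hpairs (Finset.ext fun n => ?_)
  simp only [Finset.mem_insert, Finset.mem_singleton]
  rw [h₁.eq_or_eq_iff hp₁ hq₁ hp₁3 hq₁3, h₂.eq_or_eq_iff hp₂ hq₂ hp₂3 hq₂3]
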